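/- (Theorem for Hirzebruch surfaces.) Let r ≥ 0, let β = (a,b) ∈ ℤ² with β, β + K = (a−r−2, b−2), and β + 2K = (a−2r−4, b−4) all ample (i.e., a > rb, b > 0; a−r−2 > r(b−2), b > 2; a−2r−4 > r(b−4), b > 4), and let f ∈ S_β be nondegenerate. If dim_ℂ (J₁(f) ∩ S_β) ≤ 9, then there exists η ∈ S_β such that the multiplication map R₁(f)_{β+K} → R₁(f)_{2β+K}, [α] ↦ [η·α], is injective, i.e., has rank g = dim_ℂ R₁(f)_{β+K} equal to the genus of the curve {f = 0}. (Equivalently, the curve admits a first-order deformation inside ℋ_r of rank g.) -/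

import Mathlib

open MvPolynomial

noncomputable section

/-- The Cox ring of the Hirzebruch surface: `ℂ[x₁,x₂,x₃,x₄]`. -/
abbrev S : Type := MvPolynomial (Fin 4) ℂ

/-- The ℤ²-degree of a monomial exponent vector for the Hirzebruch grading:
`deg x₁ = deg x₃ = (1,0)`, `deg x₂ = (0,1)`, `deg x₄ = (r,1)`. -/
def wdeg (r : ℕ) (c : Fin 4 →₀ ℕ) : ℤ × ℤ :=
  ((c 0 : ℤ) + (c 2 : ℤ) + (r : ℤ) * (c 3 : ℤ), (c 1 : ℤ) + (c 3 : ℤ))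

/-- The graded piece `S_γ`: the span of monomials of degree `γ`. -/
def Sgr (r : ℕ) (γ : ℤ × ℤ) : Submodule ℂ S where
  carrier := {f : S | ∀ c ∈ f.support, wdeg r c = γ}
  add_mem' := by
    intro f g hf hg c hc
    rcases Finset.mem_union.mp (MvPolynomial.support_add hc) with h | h
    · exact hf c h
    · exact hg c h
  zero_mem' := by
    intro c hc
    simp at hc
  smul_mem' := by
    intro t f hf c hc
    exact hf c (MvPolynomial.support_smul hc)

/-- The ideal `J₀(f)`, generated by `xᵢ ∂f/∂xᵢ`, `i = 1,…,4`. -/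
def J0 (f : S) : Ideal S :=
  Ideal.span {g : S | ∃ i : Fin 4, g = X i * pderiv i f}

/-- The ideal quotient `J₁(f) = J₀(f) : (x₁x₂x₃x₄)`. -/
def J1 (f : S) : Ideal S :=
  Submodule.colon (J0 f) (Ideal.span {(X 0 * X 1 * X 2 * X 3 : S)})

/-- The exceptional set `Z(Σ)` of the quotient construction of the Hirzebruch surface. -/
def Zexc : Set (Fin 4 → ℂ) :=
  {p | p 2 * p 3 = 0 ∧ p 0 * p 3 = 0 ∧ p 0 * p 1 = 0 ∧ p 1 * p 2 = 0}

/-- `f` is nondegenerate: `x₁∂f/∂x₁, …, x₄∂f/∂x₄` have no common zero outside `Z(Σ)`. -/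
def Nondeg (f : S) : Prop :=
  ∀ p : Fin 4 → ℂ, p ∉ Zexc → ∃ i : Fin 4, eval p (X i * pderiv i f) ≠ 0

/-- The graded piece `R₁(f)_γ = S_γ/(J₁(f) ∩ S_γ)`, realized as the image of `S_γ`
in the quotient ring `S ⧸ J₁(f)`. -/
def R1 (r : ℕ) (f : S) (γ : ℤ × ℤ) : Submodule ℂ (S ⧸ J1 f) :=
  (Sgr r γ).map (Ideal.Quotient.mkₐ ℂ (J1 f)).toLinearMap

/-- Nondegeneracy (on both sides) of the multiplication pairing
`R₁(f)_γ × R₁(f)_γ' → R₁(f)_{γ+γ'}`, stated elementwise: a class `[x]` is nonzero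
iff `x ∉ J₁(f)`, and the pairing of `[x]` and `[y]` is nonzero iff `x*y ∉ J₁(f)`. -/
def NondegPair (r : ℕ) (f : S) (γ γ' : ℤ × ℤ) : Prop :=
  (∀ x ∈ Sgr r γ, x ∉ J1 f → ∃ y ∈ Sgr r γ', x * y ∉ J1 f) ∧
  (∀ y ∈ Sgr r γ', y ∉ J1 f → ∃ x ∈ Sgr r γ, x * y ∉ J1 f)
section GenericForm

variable {k L ι : Type*} [Field k] [CommRing L] [Algebra k L]

theorem pderiv_mem_coeffsIn {M : Submodule k L} {p : MvPolynomial ι L}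
    (hp : p ∈ coeffsIn ι M) (i : ι) : pderiv i p ∈ coeffsIn ι M := by
  rw [mem_coeffsIn] at hp ⊢
  intro m
  rw [coeff_pderiv, mul_comm, ← Nat.cast_succ, ← nsmul_eq_mul]
  exact M.nsmul_mem (hp _) _

theorem monomial_one_mul_mem_coeffsIn {M : Submodule k L} {p : MvPolynomial ι L}
    (hp : p ∈ coeffsIn ι M) (m : ι →₀ ℕ) : monomial m 1 * p ∈ coeffsIn ι M := by
  rw [mem_coeffsIn] at hp ⊢
  intro n
  rw [coeff_monomial_mul']
  split_ifs
  · simpa using hp _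
  · exact M.zero_mem

theorem eval_algebraMap_mem_of_mem_coeffsIn [Fintype ι] {M : Submodule k L} {p : MvPolynomial ι L}
    (hp : p ∈ coeffsIn ι M) (t : ι → k) : eval (fun i => algebraMap k L (t i)) p ∈ M := by
  rw [eval_eq']
  refine M.sum_mem fun d _ => ?_
  have : (∏ i, algebraMap k L (t i) ^ d i) = algebraMap k L (∏ i, t i ^ d i) := by simp
  rw [this, mul_comm, ← Algebra.smul_def]
  exact M.smul_mem _ (hp d)

theorem one_mem_of_forall_pow_mem [IsDomain L] [FiniteDimensional k L] {V : Submodule k L} {w : L}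
    (hw : w ≠ 0) (h : ∀ n : ℕ, w ^ (n + 1) ∈ V) : (1 : L) ∈ V := by
  have hintegral : IsIntegral k w := Algebra.IsIntegral.isIntegral w
  have h0 := minpoly.aeval k w
  rw [Polynomial.aeval_eq_sum_range, Finset.sum_range_succ'] at h0
  have hc := minpoly.coeff_zero_ne_zero hintegral hw
  have h1 : (minpoly k w).coeff 0 • (1 : L) ∈ V := by
    rw [pow_zero] at h0
    rw [eq_neg_of_add_eq_zero_right h0]
    exact V.neg_mem (V.sum_mem fun i _ => V.smul_mem _ (h i))
  exact (V.smul_mem_iff hc).mp h1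

/-- If `v` is a generic element of the radical of the generic form `(y, z) ↦ φ(u_T y z)` on the
annihilator `V` of the `u i`, then all powers of `v` have coefficients in `V`. -/
theorem pow_mem_coeffsIn_of_radical [CharZero k] [Fintype ι]
    (φ : L →ₗ[k] k) (u : ι → L) (V : Submodule k L)
    (hV : ∀ z, z ∈ V ↔ ∀ i, φ (u i * z) = 0)
    (v : MvPolynomial ι L) (hv : v ∈ coeffsIn ι V)
    (H : ∀ z ∈ coeffsIn ι V, (∑ i, X i * C (u i)) * v * z ∈ coeffsIn ι (LinearMap.ker φ))
    (n : ℕ) : v ^ (n + 1) ∈ coeffsIn ι V := by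
  classical
  have hU : ∀ p : MvPolynomial ι L, (∀ i, C (u i) * p ∈ coeffsIn ι (LinearMap.ker φ)) →
      p ∈ coeffsIn ι V := by
    intro p hp
    rw [mem_coeffsIn]
    intro m
    rw [hV]
    intro i
    simpa using (mem_coeffsIn.mp (hp i)) m
  have hder : ∀ i, pderiv i (∑ j, X j * C (u j) : MvPolynomial ι L) = C (u i) := by
    intro i
    rw [map_sum, Finset.sum_eq_single i]
    · simp
    · intro j _ hj
      simp [pderiv_X_of_ne hj]
    · simp
  induction n with
  | zero => simpa using hv
  | succ n ih =>
    refine hU _ fun i => ?_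
    set q : MvPolynomial ι L := ∑ j, X j * C (u j) with hq
    have h1 := pderiv_mem_coeffsIn (H _ ih) i
    have h2 := H _ (pderiv_mem_coeffsIn ih i)
    have h3 : q * v * pderiv i (v ^ (n + 1)) =
        ((n + 1 : ℕ) : k) • (q * pderiv i v * v ^ (n + 1)) := by
      rw [pderiv_pow, Algebra.smul_def]
      simp only [map_natCast, Nat.add_sub_cancel]
      ring
    have h4 : q * pderiv i v * v ^ (n + 1) ∈ coeffsIn ι (LinearMap.ker φ) := by
      rw [h3] at h2
      exact (Submodule.smul_mem_iff _ (Nat.cast_ne_zero.mpr n.succ_ne_zero)).mp h2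
    rw [pderiv_mul, pderiv_mul, hder] at h1
    have h5 := Submodule.sub_mem _ (Submodule.sub_mem _ h1 h2) h4
    convert h5 using 1
    ring

/-- A generic linear combination `η` of the `u i` makes the form `(y, z) ↦ φ(η y z)` nondegenerate
on the annihilator `V` of the `u i`, provided that `1 ∉ V`. -/
theorem exists_nondegenerate_combination {F : Type*} [Field F] [Infinite F] [Algebra F k]
    [CharZero k] [IsDomain L] [FiniteDimensional k L] [Fintype ι]
    (φ : L →ₗ[k] k) (u : ι → L) (V : Submodule k L)
    (hV : ∀ z, z ∈ V ↔ ∀ i, φ (u i * z) = 0) (h1 : (1 : L) ∉ V) :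
    ∃ t : ι → F, ∀ v ∈ V,
      (∀ v' ∈ V, φ ((∑ i, algebraMap F k (t i) • u i) * v * v') = 0) → v = 0 := by
  classical
  let b := Module.finBasis k V
  let A : Matrix (Fin (Module.finrank k V)) (Fin (Module.finrank k V)) (MvPolynomial ι k) :=
    Matrix.of fun j l => ∑ i, X i * C (φ (u i * b j * b l))
  by_cases hA : A.det = 0
  · exfalso
    obtain ⟨p, hp0, hp⟩ := Matrix.exists_mulVec_eq_zero_iff.mpr hA
    let v : MvPolynomial ι L := ∑ j, C (b j : L) * map (algebraMap k L) (p j)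
    have hcoeff : ∀ (y : L) (q : MvPolynomial ι k) (m : ι →₀ ℕ),
        coeff m (C y * map (algebraMap k L) q) = coeff m q • y := by
      intro y q m
      rw [coeff_C_mul, coeff_map, mul_comm, Algebra.smul_def]
    have hv : v ∈ coeffsIn ι V := by
      refine Submodule.sum_mem _ fun j _ => ?_
      rw [mem_coeffsIn]
      intro m
      rw [hcoeff]
      exact V.smul_mem _ (b j).2
    have hb : ∀ l, (∑ i, X i * C (u i)) * v * C (b l : L) ∈ coeffsIn ι (LinearMap.ker φ) := by
      intro l
      have : (∑ i, X i * C (u i)) * v * C (b l : L) =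
          ∑ j, ∑ i, C (u i * b l * b j : L) * map (algebraMap k L) (X i * p j) := by
        simp only [v, Finset.sum_mul, Finset.mul_sum]
        refine Finset.sum_congr rfl fun j _ => Finset.sum_congr rfl fun i _ => ?_
        simp only [map_mul, map_X]
        ring
      rw [this, mem_coeffsIn]
      intro m
      have h2 := congrArg (coeff m) (congrFun hp l)
      simp only [Matrix.mulVec, dotProduct, A, Matrix.of_apply, Pi.zero_apply, coeff_zero,
        coeff_sum,
        Finset.sum_mul] at h2
      simp only [coeff_sum, hcoeff, LinearMap.mem_ker, map_sum, map_smul, smul_eq_mul]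
      rw [← h2]
      refine Finset.sum_congr rfl fun j _ => Finset.sum_congr rfl fun i _ => ?_
      rw [mul_comm (X i) (C _), mul_assoc (C _), coeff_C_mul, mul_comm]
    have H : ∀ z ∈ coeffsIn ι V,
        (∑ i, X i * C (u i)) * v * z ∈ coeffsIn ι (LinearMap.ker φ) := by
      intro z hz
      rw [z.as_sum, Finset.mul_sum]
      refine Submodule.sum_mem _ fun m _ => ?_
      have hrep := congrArg Subtype.val (b.sum_repr ⟨coeff m z, mem_coeffsIn.mp hz m⟩)
      simp only [AddSubmonoidClass.coe_finsetSum, SetLike.val_smul] at hrep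
      have : (monomial m (coeff m z) : MvPolynomial ι L) = monomial m 1 *
          ∑ l, b.repr ⟨coeff m z, mem_coeffsIn.mp hz m⟩ l • C (b l : L) := by
        conv_lhs => rw [← hrep]
        simp only [C_apply, smul_monomial, Finset.mul_sum, monomial_mul, map_sum, add_zero, one_mul]
      rw [this, mul_left_comm, Finset.mul_sum]
      refine monomial_one_mul_mem_coeffsIn (Submodule.sum_mem _ fun l _ => ?_) m
      rw [mul_smul_comm]
      exact Submodule.smul_mem _ _ (hb l)
    have hpow := pow_mem_coeffsIn_of_radical φ u V hV v hv H
    obtain ⟨j, hj⟩ : ∃ j, p j ≠ 0 := Function.ne_iff.mp hp0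
    have : Infinite k := CharZero.infinite k
    obtain ⟨t, ht⟩ : ∃ t : ι → k, eval t (p j) ≠ 0 := by
      by_contra! hcon
      exact hj (MvPolynomial.funext fun t => by simpa using hcon t)
    refine h1 (one_mem_of_forall_pow_mem
      (w := eval (fun i => algebraMap k L (t i)) v) ?_ fun n => ?_)
    · intro h0
      have h2 : ∑ j, eval t (p j) • b j = 0 := by
        apply Subtype.ext
        rw [ZeroMemClass.coe_zero, ← h0]
        simp only [v, map_sum, map_mul, eval_C, eval_map, AddSubmonoidClass.coe_finsetSum,
          SetLike.val_smul]
        refine Finset.sum_congr rfl fun l _ => ?_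
        rw [Algebra.smul_def, mul_comm, ← aeval_def]
        congr 1
        exact (aeval_algebraMap_apply L t (p l)).symm
      exact ht (Fintype.linearIndependent_iff.mp b.linearIndependent _ h2 j)
    · rw [← map_pow]
      exact eval_algebraMap_mem_of_mem_coeffsIn (hpow n) t
  · obtain ⟨t, ht⟩ : ∃ t : ι → F, eval (fun i => algebraMap F k (t i)) A.det ≠ 0 := by
      by_contra! hcon
      refine hA (MvPolynomial.funext_set (fun _ => Set.range (algebraMap F k))
        (fun _ => Set.infinite_range_of_injective (algebraMap F k).injective) fun x hx => ?_)
      choose t ht using fun i => hx i (Set.mem_univ i)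
      rw [map_zero, ← hcon t]
      simp only [ht]
    refine ⟨t, fun v hv hvv => ?_⟩
    rw [RingHom.map_det] at ht
    have h0 := Matrix.eq_zero_of_mulVec_eq_zero (v := fun j => b.repr ⟨v, hv⟩ j) ht ?_
    · have : b.repr ⟨v, hv⟩ = 0 := Finsupp.ext fun j => congrFun h0 j
      simpa using this
    · funext l
      have h2 := hvv (b l) (b l).2
      have hrep := congrArg Subtype.val (b.sum_repr ⟨v, hv⟩)
      simp only [AddSubmonoidClass.coe_finsetSum, SetLike.val_smul] at hrep
      rw [← hrep] at h2
      simp only [Matrix.mulVec, dotProduct, RingHom.mapMatrix_apply, Matrix.map_apply, A,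
        Matrix.of_apply, map_sum,
        map_mul, eval_X, eval_C, Pi.zero_apply]
      rw [← h2]
      simp only [Finset.mul_sum, Finset.sum_mul, map_sum, smul_mul_assoc, mul_smul_comm, map_smul,
        smul_eq_mul]
      refine Finset.sum_congr rfl fun j _ => Finset.sum_congr rfl fun i _ => ?_
      rw [mul_right_comm (u i)]
      ring

end GenericForm

/-! ### The grading -/

theorem wdeg_add (r : ℕ) (c d : Fin 4 →₀ ℕ) : wdeg r (c + d) = wdeg r c + wdeg r d := by
  simp only [wdeg, Finsupp.coe_add, Pi.add_apply, Nat.cast_add, Prod.mk_add_mk, Prod.mk.injEq]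
  constructor <;> ring

theorem wdeg_eq_of_coeff_ne_zero {r : ℕ} {γ : ℤ × ℤ} {f : S} (hf : f ∈ Sgr r γ)
    {c : Fin 4 →₀ ℕ} (hc : coeff c f ≠ 0) : wdeg r c = γ :=
  hf c (mem_support_iff.mpr hc)

theorem monomial_mem_Sgr (r : ℕ) (c : Fin 4 →₀ ℕ) (t : ℂ) :
    monomial c t ∈ Sgr r (wdeg r c) := by
  intro d hd
  rw [Finset.mem_singleton.mp (support_monomial_subset hd)]

theorem mul_mem_Sgr {r : ℕ} {γ δ : ℤ × ℤ} {f g : S} (hf : f ∈ Sgr r γ) (hg : g ∈ Sgr r δ) :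
    f * g ∈ Sgr r (γ + δ) := by
  classical
  intro c hc
  obtain ⟨d, hd, e, he, rfl⟩ := Finset.mem_add.mp (support_mul f g hc)
  rw [wdeg_add, hf d hd, hg e he]

theorem C_mem_Sgr (r : ℕ) (t : ℂ) : C t ∈ Sgr r 0 := by
  have h : wdeg r 0 = 0 := by simp [wdeg]
  exact h ▸ monomial_mem_Sgr r 0 t

theorem one_mem_Sgr (r : ℕ) : (1 : S) ∈ Sgr r 0 := by
  simpa using C_mem_Sgr r 1

theorem pow_mem_Sgr {r : ℕ} {γ : ℤ × ℤ} {f : S} (hf : f ∈ Sgr r γ) (n : ℕ) :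
    f ^ n ∈ Sgr r (n • γ) := by
  induction n with
  | zero => simpa using one_mem_Sgr r
  | succ n ih =>
    rw [pow_succ, succ_nsmul]
    exact mul_mem_Sgr ih hf

theorem X_pow_mem_Sgr (r : ℕ) (i : Fin 4) (n : ℕ) :
    (X i ^ n : S) ∈ Sgr r (wdeg r (Finsupp.single i n)) := by
  rw [X_pow_eq_monomial]
  exact monomial_mem_Sgr _ _ _

/-- The projection of `S` onto its graded piece of degree `γ`. -/
def grProj (r : ℕ) (γ : ℤ × ℤ) : S →ₗ[ℂ] S :=
  weightedHomogeneousComponent ![((1 : ℤ), (0 : ℤ)), (0, 1), (1, 0), ((r : ℤ), 1)] γ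

theorem coeff_grProj (r : ℕ) (γ : ℤ × ℤ) (p : S) (c : Fin 4 →₀ ℕ) :
    coeff c (grProj r γ p) = if wdeg r c = γ then coeff c p else 0 := by
  classical
  rw [grProj, coeff_weightedHomogeneousComponent]
  congr 2
  rw [Finsupp.weight_apply, Finsupp.sum_fintype _ _ (by simp)]
  simp [Fin.sum_univ_four, wdeg, mul_comm, Prod.ext_iff]

theorem grProj_mem (r : ℕ) (γ : ℤ × ℤ) (p : S) : grProj r γ p ∈ Sgr r γ := by
  intro c hc
  rw [mem_support_iff, coeff_grProj] at hc
  by_contra h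
  simp [h] at hc

theorem grProj_of_mem {r : ℕ} {γ : ℤ × ℤ} {p : S} (hp : p ∈ Sgr r γ) : grProj r γ p = p := by
  ext c
  rw [coeff_grProj]
  split_ifs with h
  · rfl
  · by_contra h'
    exact h (wdeg_eq_of_coeff_ne_zero hp (Ne.symm h'))

theorem grProj_of_mem_of_ne {r : ℕ} {γ δ : ℤ × ℤ} {p : S} (hp : p ∈ Sgr r δ) (h : δ ≠ γ) :
    grProj r γ p = 0 := by
  ext c
  rw [coeff_grProj, coeff_zero]
  split_ifs with h'
  · by_contra h0
    exact h ((wdeg_eq_of_coeff_ne_zero hp h0).symm.trans h')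
  · rfl

theorem grProj_mul {r : ℕ} {γ δ : ℤ × ℤ} (p : S) {q : S} (hq : q ∈ Sgr r δ) :
    grProj r γ (p * q) = grProj r (γ - δ) p * q := by
  induction p using MvPolynomial.induction_on' with
  | monomial m t =>
    have hm := monomial_mem_Sgr r m t
    by_cases h : wdeg r m + δ = γ
    · rw [← h, add_sub_cancel_right, grProj_of_mem hm, grProj_of_mem (mul_mem_Sgr hm hq)]
    · rw [grProj_of_mem_of_ne (mul_mem_Sgr hm hq) h,
        grProj_of_mem_of_ne hm (fun h' => h (by rw [h', sub_add_cancel])), zero_mul]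
  | add p₁ p₂ h₁ h₂ => rw [add_mul, map_add, map_add, h₁, h₂, add_mul]

theorem exists_homogeneous_combination {n : ℕ} {r : ℕ} {γ δ : ℤ × ℤ} {F : Fin n → S}
    (hF : ∀ i, F i ∈ Sgr r δ) {e : S} (he : e ∈ Sgr r γ) (h : e ∈ Ideal.span (Set.range F)) :
    ∃ a : Fin n → S, (∀ i, a i ∈ Sgr r (γ - δ)) ∧ e = ∑ i, a i * F i := by
  obtain ⟨c, hc⟩ := Ideal.mem_span_range_iff_exists_fun.mp h
  refine ⟨fun i => grProj r (γ - δ) (c i), fun i => grProj_mem _ _ _, ?_⟩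
  rw [← grProj_of_mem he, ← hc, map_sum]
  exact Finset.sum_congr rfl fun i _ => grProj_mul _ (hF i)

theorem exists_homogeneous_pair {r : ℕ} {γ δ : ℤ × ℤ} {F₁ F₂ : S}
    (h₁ : F₁ ∈ Sgr r δ) (h₂ : F₂ ∈ Sgr r δ) {e : S} (he : e ∈ Sgr r γ)
    (h : e ∈ Ideal.span {F₁, F₂}) :
    ∃ a ∈ Sgr r (γ - δ), ∃ b ∈ Sgr r (γ - δ), e = a * F₁ + b * F₂ := by
  obtain ⟨a, b, hab⟩ := Ideal.mem_span_pair.mp h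
  refine ⟨grProj r (γ - δ) a, grProj_mem _ _ _, grProj r (γ - δ) b, grProj_mem _ _ _, ?_⟩
  rw [← grProj_of_mem he, ← hab, map_add, grProj_mul _ h₁, grProj_mul _ h₂]

theorem mem_Sgr_of_mul_mem {r : ℕ} {γ δ : ℤ × ℤ} {F p : S} (hF : F ∈ Sgr r δ) (h0 : F ≠ 0)
    (h : p * F ∈ Sgr r γ) : p ∈ Sgr r (γ - δ) := by
  have := grProj_of_mem h
  rw [grProj_mul _ hF] at this
  rw [← mul_right_cancel₀ h0 this]
  exact grProj_mem _ _ _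

/-! ### Gluing -/

theorem exists_eq_X_pow_mul_add {ε : S} {i k : Fin 4} {s : ℕ}
    (h : ∀ c, coeff c ε ≠ 0 → s ≤ c i ∨ s ≤ c k) :
    ∃ σ τ : S, ε = X i ^ s * σ + X k ^ s * τ := by
  suffices ε ∈ Ideal.span {(X i ^ s : S), X k ^ s} by
    obtain ⟨a, b, hab⟩ := Ideal.mem_span_pair.mp this
    exact ⟨a, b, by rw [← hab]; ring⟩
  rw [ε.as_sum]
  refine Ideal.sum_mem _ fun c hc => ?_
  have key : ∀ j : Fin 4, s ≤ c j → (X j ^ s : S) ∣ monomial c (coeff c ε) := by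
    intro j hj
    rw [X_pow_eq_monomial, monomial_dvd_monomial]
    exact ⟨Or.inr (Finsupp.single_le_iff.mpr hj), one_dvd _⟩
  rcases h c (mem_support_iff.mp hc) with h | h
  · exact Ideal.mem_of_dvd _ (key i h) (Ideal.subset_span (by simp))
  · exact Ideal.mem_of_dvd _ (key k h) (Ideal.subset_span (by simp))

theorem X_pow_dvd_of_dvd_X_pow_mul {i k : Fin 4} (hik : i ≠ k) {s : ℕ} {p : S}
    (h : X i ^ s ∣ X k ^ s * p) : X i ^ s ∣ p := by
  refine (X_prime (i := i)).pow_dvd_of_dvd_mul_left s (fun h' => ?_) h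
  have := (X_prime (i := i)).dvd_of_dvd_pow h'
  exact hik (X_dvd_X.mp this)

theorem mem_span_pair_of_glue {F₁ F₂ e a₁ b₁ a₂ b₂ ε : S} (hF₂ : F₂ ≠ 0) {i k : Fin 4}
    (hik : i ≠ k) {s : ℕ} (h₁ : X i ^ s * e = a₁ * F₁ + b₁ * F₂)
    (h₂ : X k ^ s * e = a₂ * F₁ + b₂ * F₂) (hε : X k ^ s * a₁ - X i ^ s * a₂ = ε * F₂)
    (hs : ∀ c, coeff c ε ≠ 0 → s ≤ c i ∨ s ≤ c k) : e ∈ Ideal.span {F₁, F₂} := by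
  obtain ⟨τ, σ, rfl⟩ := exists_eq_X_pow_mul_add hs
  have hA : X k ^ s * (a₁ - σ * F₂) = X i ^ s * (a₂ + τ * F₂) := by linear_combination hε
  have hB : X k ^ s * (b₁ + σ * F₁) = X i ^ s * (b₂ - τ * F₁) := by
    apply mul_right_cancel₀ hF₂
    linear_combination (X i ^ s) * h₂ - (X k ^ s) * h₁ - F₁ * hA
  obtain ⟨A, hA'⟩ := X_pow_dvd_of_dvd_X_pow_mul hik (Dvd.intro _ hA.symm)
  obtain ⟨B, hB'⟩ := X_pow_dvd_of_dvd_X_pow_mul hik (Dvd.intro _ hB.symm)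
  refine Ideal.mem_span_pair.mpr ⟨A, B, ?_⟩
  apply mul_left_cancel₀ (pow_ne_zero s (X_ne_zero i) : (X i ^ s : S) ≠ 0)
  linear_combination (-F₁) * hA' - F₂ * hB' - h₁

theorem exponent_le_of_X_pow_mul_eq {ε A B D : S} {i j k l : Fin 4} {s : ℕ} (hi : l ≠ i)
    (hj : l ≠ j) (hk : l ≠ k) (h : X l ^ s * ε = X i ^ s * A + X j ^ s * B + X k ^ s * D)
    {c : Fin 4 →₀ ℕ} (hc : coeff c ε ≠ 0) : s ≤ c i ∨ s ≤ c j ∨ s ≤ c k := by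
  classical
  by_contra! hcon
  have key : ∀ m : Fin 4, l ≠ m → c m < s → ∀ p : S,
      coeff (Finsupp.single l s + c) (X m ^ s * p) = 0 := by
    intro m hm hlt p
    rw [X_pow_eq_monomial, coeff_monomial_mul', if_neg]
    rw [Finsupp.single_le_iff]
    simpa [Finsupp.single_apply, hm] using hlt
  have := congrArg (coeff (Finsupp.single l s + c)) h
  rw [coeff_add, coeff_add, key i hi hcon.1, key j hj hcon.2.1, key k hk hcon.2.2,
    X_pow_eq_monomial, coeff_monomial_mul] at this
  exact hc (by simpa using this)

/-- The factors `X 1 ^ s`, `X 3 ^ s` can be cancelled from membership in `(F₁, F₂)`. -/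
theorem X_pow_mul_mem_span_pair {r : ℕ} {a b : ℤ} (hab : (r : ℤ) * b < a) {j : ℤ}
    (hj : j = 1 ∨ j = 2) {F₁ F₂ e : S} (hF₁ : F₁ ∈ Sgr r (a, b)) (hF₂ : F₂ ∈ Sgr r (a, b))
    (hF₂0 : F₂ ≠ 0) (hcop : ∀ u v, F₁ * u = F₂ * v → F₂ ∣ u) (he : e ∈ Sgr r (j * a, j * b))
    {i k : Fin 4} (hik : (i = 0 ∧ k = 2) ∨ (i = 2 ∧ k = 0)) {s : ℕ}
    (h : ∀ p ∈ ({i, k} : Set (Fin 4)), ∀ q ∈ ({1, 3} : Set (Fin 4)),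
      (X p * X q : S) ^ s * e ∈ Ideal.span {F₁, F₂}) :
    X i ^ s * e ∈ Ideal.span {F₁, F₂} := by
  have hmem : ∀ p ∈ ({i, k} : Set (Fin 4)), ∀ q : Fin 4,
      (X p * X q : S) ^ s * e ∈ Sgr r (wdeg r (Finsupp.single p s) + wdeg r (Finsupp.single q s) +
        (j * a, j * b)) := by
    intro p _ q
    rw [mul_pow]
    exact mul_mem_Sgr (mul_mem_Sgr (X_pow_mem_Sgr r p s) (X_pow_mem_Sgr r q s)) he
  have hex := fun p hp q hq => exists_homogeneous_pair hF₁ hF₂ (hmem p hp q) (h p hp q hq)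
  obtain ⟨a₁, ha₁, b₁, -, h₁⟩ := hex i (by simp) 1 (by simp)
  obtain ⟨a₂, ha₂, b₂, -, h₂⟩ := hex i (by simp) 3 (by simp)
  obtain ⟨a₃, -, b₃, -, h₃⟩ := hex k (by simp) 1 (by simp)
  obtain ⟨a₄, -, b₄, -, h₄⟩ := hex k (by simp) 3 (by simp)
  obtain ⟨ε, hε⟩ := hcop (X 3 ^ s * a₁ - X 1 ^ s * a₂) (X 1 ^ s * b₂ - X 3 ^ s * b₁)
    (by linear_combination X 1 ^ s * h₂ - X 3 ^ s * h₁)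
  obtain ⟨ε', hε'⟩ := hcop (X 3 ^ s * a₃ - X 1 ^ s * a₄) (X 1 ^ s * b₄ - X 3 ^ s * b₃)
    (by linear_combination X 1 ^ s * h₄ - X 3 ^ s * h₃)
  obtain ⟨δ, hδ⟩ := hcop (X k ^ s * a₁ - X i ^ s * a₃) (X i ^ s * b₃ - X k ^ s * b₁)
    (by linear_combination X i ^ s * h₃ - X k ^ s * h₁)
  obtain ⟨δ', hδ'⟩ := hcop (X k ^ s * a₂ - X i ^ s * a₄) (X i ^ s * b₄ - X k ^ s * b₂)
    (by linear_combination X i ^ s * h₄ - X k ^ s * h₂)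
  have hrel : X k ^ s * ε = X i ^ s * ε' + X 3 ^ s * δ + X 1 ^ s * (-δ') := by
    apply mul_right_cancel₀ hF₂0
    linear_combination (-X k ^ s) * hε + X i ^ s * hε' + X 3 ^ s * hδ - X 1 ^ s * hδ'
  have hεdeg : ε ∈ Sgr r (wdeg r (Finsupp.single i s) + wdeg r (Finsupp.single 1 s) +
      wdeg r (Finsupp.single 3 s) + (j * a, j * b) - (a, b) - (a, b)) := by
    apply mem_Sgr_of_mul_mem hF₂ hF₂0
    rw [mul_comm ε, ← hε]
    refine Submodule.sub_mem _ ?_ ?_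
    · convert mul_mem_Sgr (X_pow_mem_Sgr r 3 s) ha₁ using 2
      abel
    · convert mul_mem_Sgr (X_pow_mem_Sgr r 1 s) ha₂ using 2
      abel
  refine mem_span_pair_of_glue (i := 1) (k := 3) (s := s) (a₁ := a₁) (b₁ := b₁) (a₂ := a₂)
    (b₂ := b₂) (ε := ε) hF₂0 (by decide) (by linear_combination h₁) (by linear_combination h₂)
    (by linear_combination hε) fun c hc => ?_
  have hexp := exponent_le_of_X_pow_mul_eq (by rcases hik with h | h <;> simp [h.1, h.2])
    (by rcases hik with h | h <;> simp [h.2]) (by rcases hik with h | h <;> simp [h.2]) hrel hc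
  have hdeg := wdeg_eq_of_coeff_ne_zero hεdeg hc
  by_contra! hcon
  have hi : s ≤ c i := by omega
  have hdeg₁ : (c 0 : ℤ) + c 2 + r * c 3 = s + r * s + (j - 2) * a := by
    have := congrArg Prod.fst hdeg
    rcases hik with h | h <;> simp [wdeg, h.1] at this <;> linear_combination this
  have hdeg₂ : (c 1 : ℤ) + c 3 = 2 * s + (j - 2) * b := by
    have := congrArg Prod.snd hdeg
    rcases hik with h | h <;> simp [wdeg, h.1] at this <;> linear_combination this
  rcases hj with rfl | rfl
  · have h02 : (s : ℤ) ≤ c 0 + c 2 := by rcases hik with h | h <;> rw [h.1] at hi <;> omega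
    have hc3 : (s : ℤ) - b + 1 ≤ c 3 := by omega
    have hr : (0 : ℤ) ≤ r := Int.natCast_nonneg r
    nlinarith
  · omega

theorem mem_span_pair_of_pow_mul_mem {r : ℕ} {a b : ℤ} (hab : (r : ℤ) * b < a) (hb : 0 < b)
    {j : ℤ} (hj : j = 1 ∨ j = 2) {F₀ F₁ F₂ e : S} (hF₁ : F₁ ∈ Sgr r (a, b))
    (hF₂ : F₂ ∈ Sgr r (a, b)) (hF₂0 : F₂ ≠ 0) (hcop : ∀ u v, F₁ * u = F₂ * v → F₂ ∣ u)
    (he : e ∈ Sgr r (j * a, j * b)) {m s : ℕ}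
    (hnull : ∀ p ∈ ({0, 2} : Set (Fin 4)), ∀ q ∈ ({1, 3} : Set (Fin 4)),
      (X p * X q : S) ^ s ∈ Ideal.span {F₀ ^ m, F₁, F₂})
    (h : F₀ ^ m * e ∈ Ideal.span {F₁, F₂}) : e ∈ Ideal.span {F₁, F₂} := by
  have h4 : ∀ p ∈ ({0, 2} : Set (Fin 4)), ∀ q ∈ ({1, 3} : Set (Fin 4)),
      (X p * X q : S) ^ s * e ∈ Ideal.span {F₁, F₂} := by
    intro p hp q hq
    obtain ⟨u, v, hv, huv⟩ := Ideal.mem_span_insert.mp (hnull p hp q hq)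
    rw [huv, add_mul, mul_assoc]
    exact Ideal.add_mem _ (Ideal.mul_mem_left _ _ h) (Ideal.mul_mem_right _ _ hv)
  have h0 := X_pow_mul_mem_span_pair hab hj hF₁ hF₂ hF₂0 hcop he (i := 0) (k := 2) (by simp) h4
  have h2 := X_pow_mul_mem_span_pair hab hj hF₁ hF₂ hF₂0 hcop he (i := 2) (k := 0) (by simp)
    (by rwa [Set.pair_comm])
  obtain ⟨a₁, ha₁, b₁, -, h₁⟩ := exists_homogeneous_pair hF₁ hF₂
    (mul_mem_Sgr (X_pow_mem_Sgr r 0 s) he) h0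
  obtain ⟨a₂, ha₂, b₂, -, h₂⟩ := exists_homogeneous_pair hF₁ hF₂
    (mul_mem_Sgr (X_pow_mem_Sgr r 2 s) he) h2
  obtain ⟨ε, hε⟩ := hcop (X 2 ^ s * a₁ - X 0 ^ s * a₂) (X 0 ^ s * b₂ - X 2 ^ s * b₁)
    (by linear_combination X 0 ^ s * h₂ - X 2 ^ s * h₁)
  have hεdeg : ε ∈ Sgr r (wdeg r (Finsupp.single 0 s) + wdeg r (Finsupp.single 2 s) +
      (j * a, j * b) - (a, b) - (a, b)) := by
    apply mem_Sgr_of_mul_mem hF₂ hF₂0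
    rw [mul_comm ε, ← hε]
    refine Submodule.sub_mem _ ?_ ?_
    · convert mul_mem_Sgr (X_pow_mem_Sgr r 2 s) ha₁ using 2
      abel
    · convert mul_mem_Sgr (X_pow_mem_Sgr r 0 s) ha₂ using 2
      abel
  refine mem_span_pair_of_glue (i := 0) (k := 2) (s := s) hF₂0 (by decide) h₁ h₂
    (by rw [hε, mul_comm]) fun c hc => ?_
  have hdeg := wdeg_eq_of_coeff_ne_zero hεdeg hc
  have hdeg₁ : (c 0 : ℤ) + c 2 + r * c 3 = 2 * s + (j - 2) * a := by
    have := congrArg Prod.fst hdeg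
    simp [wdeg] at this
    linear_combination this
  have hdeg₂ : (c 1 : ℤ) + c 3 = (j - 2) * b := by
    have := congrArg Prod.snd hdeg
    simp [wdeg] at this
    linear_combination this
  rcases hj with rfl | rfl
  · omega
  · have : c 3 = 0 := by omega
    rw [this] at hdeg₁
    simp at hdeg₁
    omega

/-! ### The net of logarithmic derivatives -/

theorem coeff_X_mul_pderiv (f : S) (i : Fin 4) (c : Fin 4 →₀ ℕ) :
    coeff c (X i * pderiv i f) = c i * coeff c f := by
  classical
  induction f using MvPolynomial.induction_on' with
  | monomial m t =>
    rw [X_mul_pderiv_monomial, coeff_smul, coeff_monomial, nsmul_eq_mul]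
    split_ifs with h
    · rw [h]
    · simp
  | add p q hp hq => rw [map_add, mul_add, coeff_add, coeff_add, hp, hq, mul_add]

theorem X_mul_pderiv_mem_Sgr {r : ℕ} {γ : ℤ × ℤ} {f : S} (hf : f ∈ Sgr r γ) (i : Fin 4) :
    X i * pderiv i f ∈ Sgr r γ := by
  intro c hc
  rw [mem_support_iff, coeff_X_mul_pderiv] at hc
  exact wdeg_eq_of_coeff_ne_zero hf (right_ne_zero_of_mul hc)

theorem exists_exponent_of_nondeg {f : S} (hnd : Nondeg f) {p : Fin 4 → ℂ} (hp : p ∉ Zexc) :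
    ∃ d, coeff d f ≠ 0 ∧ ∀ j, p j = 0 → d j = 0 := by
  obtain ⟨i, hi⟩ := hnd p hp
  rw [eval_eq'] at hi
  obtain ⟨d, -, hd⟩ := Finset.exists_ne_zero_of_sum_ne_zero hi
  refine ⟨d, ?_, fun j hj => ?_⟩
  · have := left_ne_zero_of_mul hd
    rw [coeff_X_mul_pderiv] at this
    exact right_ne_zero_of_mul this
  · by_contra h
    exact Finset.prod_ne_zero_iff.mp (right_ne_zero_of_mul hd) j (Finset.mem_univ j)
      (by rw [hj, zero_pow h])

theorem coeff_eq_zero_of_X_dvd {p : S} {j : Fin 4} (h : X j ∣ p) {d : Fin 4 →₀ ℕ}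
    (hd : d j = 0) : coeff d p = 0 := by
  classical
  obtain ⟨q, rfl⟩ := h
  rw [coeff_X_mul', if_neg (by simpa using hd)]

/-- The logarithmic derivatives of a nondegenerate `f` are linearly independent modulo the
multiples of the product of the variables. -/
theorem eq_zero_of_mul_eq_combination {r : ℕ} {a b : ℤ} (hab : (r : ℤ) * b < a) (hb : 0 < b)
    {f : S} (hf : f ∈ Sgr r (a, b)) (hnd : Nondeg f) {α : S} {c₁ c₂ c₃ : ℂ}
    (h : X 0 * X 1 * X 2 * X 3 * α = c₁ • (X 1 * pderiv 1 f) + c₂ • (X 2 * pderiv 2 f) +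
      c₃ • (X 3 * pderiv 3 f)) : c₁ = 0 ∧ c₂ = 0 ∧ c₃ = 0 := by
  have key : ∀ d : Fin 4 →₀ ℕ, coeff d f ≠ 0 → (∃ j, d j = 0) →
      c₁ * d 1 + c₂ * d 2 + c₃ * d 3 = 0 := by
    rintro d hd ⟨j, hj⟩
    have h0 : coeff d (X 0 * X 1 * X 2 * X 3 * α) = 0 := by
      refine coeff_eq_zero_of_X_dvd (j := j) ?_ hj
      have h4 : (X 0 * X 1 * X 2 * X 3 : S) = ∏ i, X i := by simp [Fin.prod_univ_four]
      rw [h4]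
      exact (Finset.dvd_prod_of_mem _ (Finset.mem_univ j)).mul_right _
    rw [h] at h0
    simp only [coeff_add, coeff_smul, coeff_X_mul_pderiv, smul_eq_mul] at h0
    apply mul_right_cancel₀ hd
    linear_combination h0
  have hdeg : ∀ d, coeff d f ≠ 0 → (d 0 : ℤ) + d 2 + r * d 3 = a ∧ (d 1 : ℤ) + d 3 = b :=
    fun d hd => Prod.ext_iff.mp (wdeg_eq_of_coeff_ne_zero hf hd)
  obtain ⟨d, hd, hd'⟩ := exists_exponent_of_nondeg hnd (p := ![1, 1, 0, 0]) (by simp [Zexc])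
  obtain ⟨e, he, he'⟩ := exists_exponent_of_nondeg hnd (p := ![1, 0, 0, 1]) (by simp [Zexc])
  obtain ⟨l, hl, hl'⟩ := exists_exponent_of_nondeg hnd (p := ![0, 0, 1, 1]) (by simp [Zexc])
  have hd2 : d 2 = 0 := hd' 2 (by simp)
  have hd3 : d 3 = 0 := hd' 3 (by simp)
  have he1 : e 1 = 0 := he' 1 (by simp)
  have he2 : e 2 = 0 := he' 2 (by simp)
  have hl0 : l 0 = 0 := hl' 0 (by simp)
  have hl1 : l 1 = 0 := hl' 1 (by simp)
  have kd := key d hd ⟨2, hd2⟩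
  have ke := key e he ⟨1, he1⟩
  have kl := key l hl ⟨0, hl0⟩
  have gd := hdeg d hd
  have ge := hdeg e he
  have gl := hdeg l hl
  have hd1 : d 1 ≠ 0 := by omega
  have he3 : e 3 ≠ 0 := by omega
  have hl2 : l 2 ≠ 0 := by
    intro h0
    have : (l 3 : ℤ) = b := by omega
    rw [h0, hl0, this] at gl
    simp at gl
    omega
  rw [hd2, hd3] at kd
  rw [he1, he2] at ke
  rw [hl1] at kl
  have h1 : c₁ = 0 := by simpa [hd1] using kd
  have h3 : c₃ = 0 := by simpa [he3] using ke
  rw [h3] at kl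
  exact ⟨h1, by simpa [hl2] using kl, h3⟩

theorem X_zero_mul_pderiv_eq {r : ℕ} {a b : ℤ} (hb : 0 < b) {f : S} (hf : f ∈ Sgr r (a, b)) :
    X 0 * pderiv 0 f = ((a : ℂ) / b) • (X 1 * pderiv 1 f) + (-1 : ℂ) • (X 2 * pderiv 2 f) +
      ((a : ℂ) / b - r) • (X 3 * pderiv 3 f) := by
  ext c
  simp only [coeff_add, coeff_smul, coeff_X_mul_pderiv, smul_eq_mul]
  by_cases hc : coeff c f = 0
  · simp [hc]
  · obtain ⟨h1, h2⟩ := Prod.ext_iff.mp (wdeg_eq_of_coeff_ne_zero hf hc)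
    simp only [wdeg] at h1 h2
    have hb' : (b : ℂ) ≠ 0 := Int.cast_ne_zero.mpr hb.ne'
    have h1' : (c 0 : ℂ) + c 2 + r * c 3 = a := by exact_mod_cast congrArg (Int.cast : ℤ → ℂ) h1
    have h2' : (c 1 : ℂ) + c 3 = b := by exact_mod_cast congrArg (Int.cast : ℤ → ℂ) h2
    field_simp
    linear_combination b * h1' - a * h2'

theorem J0_eq_span {r : ℕ} {a b : ℤ} (hb : 0 < b) {f : S} (hf : f ∈ Sgr r (a, b)) :
    J0 f = Ideal.span {X 1 * pderiv 1 f, X 2 * pderiv 2 f, X 3 * pderiv 3 f} := by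
  have hmem : ∀ i : Fin 4, i ≠ 0 → X i * pderiv i f ∈
      Ideal.span {X 1 * pderiv 1 f, X 2 * pderiv 2 f, X 3 * pderiv 3 f} := by
    intro i hi
    apply Ideal.subset_span
    fin_cases i
    · exact absurd rfl hi
    · simp
    · simp
    · simp
  apply le_antisymm
  · refine Ideal.span_le.mpr ?_
    rintro _ ⟨i, rfl⟩
    by_cases hi : i = 0
    · subst hi
      rw [X_zero_mul_pderiv_eq hb hf]
      refine Ideal.add_mem _ (Ideal.add_mem _ ?_ ?_) ?_ <;>
        exact Submodule.smul_of_tower_mem _ _ (hmem _ (by decide))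
    · exact hmem i hi
  · refine Ideal.span_le.mpr ?_
    rintro _ (rfl | rfl | rfl) <;> exact Ideal.subset_span ⟨_, rfl⟩

/-- Three elements of degree `(a, b)` generating `J₀(f)`, without common zeros outside the
exceptional set, the last two of them coprime. -/
structure IsNet (r : ℕ) (a b : ℤ) (f F₀ F₁ F₂ : S) : Prop where
  mem₀ : F₀ ∈ Sgr r (a, b)
  mem₁ : F₁ ∈ Sgr r (a, b)
  mem₂ : F₂ ∈ Sgr r (a, b)
  span_eq : J0 f = Ideal.span {F₀, F₁, F₂}
  ne_zero : F₂ ≠ 0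
  dvd_of_mul_eq : ∀ u v, F₁ * u = F₂ * v → F₂ ∣ u
  eq_zero : ∀ (α : S) (c₀ c₁ c₂ : ℂ),
    X 0 * X 1 * X 2 * X 3 * α = c₀ • F₀ + c₁ • F₁ + c₂ • F₂ → c₀ = 0 ∧ c₁ = 0 ∧ c₂ = 0
  pow_mem : ∀ m : ℕ, ∃ s : ℕ, ∀ p ∈ ({0, 2} : Set (Fin 4)), ∀ q ∈ ({1, 3} : Set (Fin 4)),
    (X p * X q : S) ^ s ∈ Ideal.span {F₀ ^ m, F₁, F₂}

theorem exists_pow_mem_span {f F₀ F₁ F₂ : S} (hnd : Nondeg f)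
    (hJ : J0 f = Ideal.span {F₀, F₁, F₂}) (m : ℕ) :
    ∃ s : ℕ, ∀ p ∈ ({0, 2} : Set (Fin 4)), ∀ q ∈ ({1, 3} : Set (Fin 4)),
      (X p * X q : S) ^ s ∈ Ideal.span {F₀ ^ m, F₁, F₂} := by
  have hrad : ∀ p ∈ ({0, 2} : Set (Fin 4)), ∀ q ∈ ({1, 3} : Set (Fin 4)),
      (X p * X q : S) ∈ (Ideal.span {F₀ ^ m, F₁, F₂}).radical := by
    intro p hp q hq
    rw [← vanishingIdeal_zeroLocus_eq_radical (K := ℂ), mem_vanishingIdeal_iff]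
    intro z hz
    rw [mem_zeroLocus_iff] at hz
    have h0 : eval z F₀ = 0 := by
      have := hz (F₀ ^ m) (Ideal.subset_span (by simp))
      rw [map_pow] at this
      exact eq_zero_of_pow_eq_zero this
    have h1 : eval z F₁ = 0 := hz F₁ (Ideal.subset_span (by simp))
    have h2 : eval z F₂ = 0 := hz F₂ (Ideal.subset_span (by simp))
    have hJz : J0 f ≤ RingHom.ker (eval z) := by
      rw [hJ, Ideal.span_le]
      rintro _ (rfl | rfl | rfl) <;> assumption
    have hzZ : z ∈ Zexc := by
      by_contra hcon
      obtain ⟨i, hi⟩ := hnd z hcon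
      exact hi (hJz (Ideal.subset_span ⟨i, rfl⟩))
    obtain ⟨z1, z2, z3, z4⟩ := hzZ
    have : z p * z q = 0 := by
      rcases hp with rfl | rfl <;> rcases hq with rfl | rfl
      · exact z3
      · exact z2
      · rw [mul_comm]; exact z4
      · exact z1
    simpa using this
  choose! n hn using hrad
  refine ⟨n 0 1 + n 0 3 + n 2 1 + n 2 3, fun p hp q hq => ?_⟩
  refine Ideal.pow_mem_of_pow_mem _ (hn p hp q hq) ?_
  rcases hp with rfl | rfl <;> rcases hq with rfl | rfl <;> omega

theorem exists_isRelPrime_add {E₁ E₂ E₃ : S} (h3 : E₃ ≠ 0)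
    (h : ∀ d : S, Irreducible d → d ∣ E₁ → d ∣ E₂ → ¬ d ∣ E₃) :
    ∃ t : ℂ, IsRelPrime (E₂ + t • E₁) E₃ := by
  classical
  by_contra! hcon
  have hd : ∀ t : ℂ, ∃ p : (UniqueFactorizationMonoid.factors E₃).toFinset,
      (p : S) ∣ E₂ + t • E₁ := by
    intro t
    have h1 := hcon t
    simp only [IsRelPrime, not_forall] at h1
    obtain ⟨d, hd1, hd2, hd3⟩ := h1
    obtain ⟨i, hi, hid⟩ := WfDvdMonoid.exists_irreducible_factor hd3
      (ne_zero_of_dvd_ne_zero h3 hd2)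
    obtain ⟨q, hq, hiq⟩ := UniqueFactorizationMonoid.exists_mem_factors_of_dvd h3 hi
      (hid.trans hd2)
    exact ⟨⟨q, Multiset.mem_toFinset.mpr hq⟩, hiq.symm.dvd.trans (hid.trans hd1)⟩
  choose p hp using hd
  obtain ⟨t, t', htt, hpp⟩ := Finite.exists_ne_map_eq_of_infinite p
  have hmem := Multiset.mem_toFinset.mp (p t).2
  have h1 := dvd_sub (hp t) (hpp ▸ hp t')
  have h2 : (p t : S) ∣ E₁ := by
    have : (E₁ : S) = (t - t')⁻¹ • ((E₂ + t • E₁) - (E₂ + t' • E₁)) := by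
      rw [add_sub_add_left_eq_sub, ← sub_smul, smul_smul, inv_mul_cancel₀ (sub_ne_zero.mpr htt),
        one_smul]
    rw [this, smul_eq_C_mul]
    exact h1.mul_left _
  refine h _ (UniqueFactorizationMonoid.irreducible_of_factor _ hmem) h2 ?_
    (UniqueFactorizationMonoid.dvd_of_mem_factors hmem)
  have := dvd_sub (hp t) (smul_eq_C_mul E₁ t ▸ h2.mul_left (C t))
  simpa using this

theorem exists_isNet {r : ℕ} {a b : ℤ} (hab : (r : ℤ) * b < a) (hb : 0 < b) {f : S}
    (hf : f ∈ Sgr r (a, b)) (hnd : Nondeg f) : ∃ F₀ F₁ F₂, IsNet r a b f F₀ F₁ F₂ := by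
  have hJ := J0_eq_span hb hf
  have h3 : X 3 * pderiv 3 f ≠ 0 := by
    intro h0
    have := eq_zero_of_mul_eq_combination hab hb hf hnd (α := 0) (c₁ := 0) (c₂ := 0) (c₃ := 1)
      (by simp [h0])
    simp at this
  obtain ⟨t, ht⟩ := exists_isRelPrime_add (E₁ := X 1 * pderiv 1 f) (E₂ := X 2 * pderiv 2 f) h3 (by
    intro d hd h1 h2 h3'
    obtain ⟨s, hs⟩ := exists_pow_mem_span hnd hJ 1
    have hle : Ideal.span {(X 1 * pderiv 1 f) ^ 1, X 2 * pderiv 2 f, X 3 * pderiv 3 f} ≤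
        Ideal.span {d} := by
      rw [Ideal.span_le, pow_one]
      rintro _ (rfl | rfl | rfl)
      exacts [Ideal.mem_span_singleton.mpr h1, Ideal.mem_span_singleton.mpr h2,
        Ideal.mem_span_singleton.mpr h3']
    have hdvd : ∀ p ∈ ({0, 2} : Set (Fin 4)), ∀ q ∈ ({1, 3} : Set (Fin 4)),
        Associated d (X p : S) ∨ Associated d (X q : S) := by
      intro p hp q hq
      have := hd.prime.dvd_of_dvd_pow (Ideal.mem_span_singleton.mp (hle (hs p hp q hq)))
      rcases hd.prime.dvd_or_dvd this with h | h
      · exact Or.inl (hd.associated_of_dvd (X_prime).irreducible h)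
      · exact Or.inr (hd.associated_of_dvd (X_prime).irreducible h)
    have hne : ∀ i j : Fin 4, i ≠ j → Associated d (X i) → ¬ Associated d (X j) :=
      fun i j hij hi hj => hij (X_dvd_X.mp (hi.symm.trans hj).dvd)
    rcases hdvd 0 (by simp) 1 (by simp) with h | h <;>
      rcases hdvd 2 (by simp) 3 (by simp) with h' | h' <;>
      exact hne _ _ (by decide) h h')
  have hspan : J0 f =
      Ideal.span
        {X 1 * pderiv 1 f, X 2 * pderiv 2 f + t • (X 1 * pderiv 1 f), X 3 * pderiv 3 f} := by
    rw [hJ]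
    set E₁ := X 1 * pderiv 1 f
    set E₂ := X 2 * pderiv 2 f
    set E₃ := X 3 * pderiv 3 f
    have m1 : ∀ G : S, E₁ ∈ Ideal.span {E₁, G, E₃} := fun G => Ideal.subset_span (by simp)
    have m2 : ∀ G : S, G ∈ Ideal.span {E₁, G, E₃} := fun G => Ideal.subset_span (by simp)
    have m3 : ∀ G : S, E₃ ∈ Ideal.span {E₁, G, E₃} := fun G => Ideal.subset_span (by simp)
    apply le_antisymm <;> refine Ideal.span_le.mpr ?_ <;> rintro _ (rfl | rfl | rfl)
    · exact m1 _
    · have := Ideal.sub_mem _ (m2 (E₂ + t • E₁))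
        (Submodule.smul_of_tower_mem _ t (m1 (E₂ + t • E₁)))
      simpa using this
    · exact m3 _
    · exact m1 _
    · exact Ideal.add_mem _ (m2 _) (Submodule.smul_of_tower_mem _ t (m1 _))
    · exact m3 _
  have hE := X_mul_pderiv_mem_Sgr hf
  refine ⟨_, _, _, hE 1, Submodule.add_mem _ (hE 2) (Submodule.smul_mem _ t (hE 1)), hE 3, hspan,
    h3, fun u v huv => ht.symm.dvd_of_dvd_mul_left (Dvd.intro _ huv.symm), ?_,
    exists_pow_mem_span hnd hspan⟩
  intro α c₀ c₁ c₂ h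
  obtain ⟨h1, h2, h3⟩ := eq_zero_of_mul_eq_combination hab hb hf hnd (α := α)
    (c₁ := c₀ + c₁ * t) (c₂ := c₁) (c₃ := c₂) (by rw [h]; module)
  subst h2 h3
  simpa using h1

/-! ### Dimensions of the graded pieces -/

theorem Sgr_eq_restrictSupport (r : ℕ) (γ : ℤ × ℤ) :
    Sgr r γ = restrictSupport ℂ {c | wdeg r c = γ} := by
  ext p
  rw [mem_restrictSupport_iff]
  rfl

theorem finite_setOf_wdeg_eq (r : ℕ) (γ : ℤ × ℤ) : {c | wdeg r c = γ}.Finite := by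
  refine (Set.finite_Iic (Finsupp.equivFunOnFinite.symm
    fun _ : Fin 4 => γ.1.toNat + γ.2.toNat)).subset ?_
  rintro c rfl i
  have : (0 : ℤ) ≤ r * c 3 := by positivity
  simp only [wdeg, Finsupp.equivFunOnFinite_symm_apply_apply]
  fin_cases i <;> simp only [Fin.zero_eta, Fin.mk_one, Fin.reduceFinMk] <;> omega

instance finiteDimensional_Sgr (r : ℕ) (γ : ℤ × ℤ) : FiniteDimensional ℂ (Sgr r γ) := by
  rw [Sgr_eq_restrictSupport]
  have := (finite_setOf_wdeg_eq r γ).to_subtype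
  exact Module.Finite.of_basis (basisRestrictSupport ℂ {c | wdeg r c = γ})

theorem finrank_Sgr_eq_card (r : ℕ) (γ : ℤ × ℤ) :
    Module.finrank ℂ (Sgr r γ) = Nat.card {c | wdeg r c = γ} := by
  rw [Sgr_eq_restrictSupport]
  exact Module.finrank_eq_nat_card_basis (basisRestrictSupport ℂ {c | wdeg r c = γ})

/-- The exponent vectors of a given degree, sorted by the exponent of the last variable. -/
theorem card_setOf_wdeg_eq (r w v : ℕ) :
    Nat.card {c | wdeg r c = ((w : ℤ) + r * v - 1, (v : ℤ))} =
      ∑ j ∈ Finset.range (v + 1), (w + r * (v - j)) := by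
  let φ : (Σ j : Fin (v + 1), Fin (w + r * (v - j))) → (Fin 4 →₀ ℕ) := fun x =>
    Finsupp.equivFunOnFinite.symm
      ![(x.2 : ℕ), v - x.1, w + r * (v - x.1) - 1 - x.2, (x.1 : ℕ)]
  have hφ : ∀ x, wdeg r (φ x) = ((w : ℤ) + r * v - 1, (v : ℤ)) := by
    rintro ⟨j, i⟩
    have hj := j.2
    have hi := i.2
    have h1 : ((v - j : ℕ) : ℤ) = v - j := by omega
    have h2 : ((w + r * (v - j) - 1 - i : ℕ) : ℤ) = w + r * (v - j) - 1 - i := by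
      have hq : ((r * (v - j) : ℕ) : ℤ) = r * (v - j) := by rw [Nat.cast_mul, h1]
      rw [← hq]
      omega
    ext
    · simp only [wdeg, φ, Finsupp.equivFunOnFinite_symm_apply_apply, Matrix.cons_val]
      rw [h2]
      ring
    · simp only [wdeg, φ, Finsupp.equivFunOnFinite_symm_apply_apply, Matrix.cons_val]
      rw [h1]
      ring
  have hbij : Function.Bijective
      (fun x => (⟨φ x, hφ x⟩ : {c | wdeg r c = ((w : ℤ) + r * v - 1, (v : ℤ))})) := by
    constructor
    · rintro ⟨j, i⟩ ⟨j', i'⟩ h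
      have h' := congrArg Subtype.val h
      have h0 := DFunLike.congr_fun h' 0
      have h3 := DFunLike.congr_fun h' 3
      simp only [φ, Finsupp.equivFunOnFinite_symm_apply_apply, Matrix.cons_val] at h0 h3
      obtain rfl := Fin.ext h3
      obtain rfl := Fin.ext h0
      rfl
    · rintro ⟨c, hc⟩
      obtain ⟨h1, h2⟩ := Prod.ext_iff.mp hc
      simp only [wdeg] at h1 h2
      have hc3 : c 3 ≤ v := by omega
      obtain ⟨l, hl⟩ := Nat.exists_eq_add_of_le hc3
      have hl' : v - c 3 = l := by omega
      have hsum : c 0 + c 2 + 1 = w + r * (v - c 3) := by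
        rw [hl']
        have : (v : ℤ) = c 3 + l := by omega
        rw [this] at h1
        zify
        linear_combination h1
      refine ⟨⟨⟨c 3, by omega⟩, ⟨c 0, by change c 0 < w + r * (v - c 3); omega⟩⟩,
        Subtype.ext (Finsupp.ext fun i => ?_)⟩
      fin_cases i
      · simp [φ]
      · simp only [φ, Finsupp.equivFunOnFinite_symm_apply_apply]
        change v - c 3 = c 1
        omega
      · simp only [φ, Finsupp.equivFunOnFinite_symm_apply_apply]
        change w + r * (v - c 3) - 1 - c 0 = c 2
        omega
      · simp [φ]
  rw [← Nat.card_congr (Equiv.ofBijective _ hbij), Nat.card_eq_fintype_card, Fintype.card_sigma]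
  simp only [Fintype.card_fin]
  exact Fin.sum_univ_eq_sum_range (fun j => w + r * (v - j)) (v + 1)

theorem two_mul_finrank_Sgr {r : ℕ} {u v : ℤ} (hv : 0 ≤ v) (hu : -1 ≤ u - r * v) :
    2 * (Module.finrank ℂ (Sgr r (u, v)) : ℤ) = (v + 1) * (2 * (u + 1) - r * v) := by
  obtain ⟨n, rfl⟩ := Int.eq_ofNat_of_zero_le hv
  obtain ⟨w, hw⟩ := Int.eq_ofNat_of_zero_le (a := u - r * n + 1) (by linarith)
  obtain rfl : u = (w : ℤ) + r * n - 1 := by linarith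
  have key : ∀ m : ℕ, 2 * (∑ j ∈ Finset.range (m + 1), ((w : ℤ) + r * j)) =
      (m + 1) * (2 * w + r * m) := by
    intro m
    induction m with
    | zero => simp
    | succ m ih =>
      rw [Finset.sum_range_succ, mul_add, ih]
      push_cast
      ring
  have hrefl := Finset.sum_range_reflect (fun j => w + r * j) (n + 1)
  simp only [Nat.add_sub_cancel] at hrefl
  rw [finrank_Sgr_eq_card, card_setOf_wdeg_eq, hrefl]
  push_cast
  rw [key]
  ring

/-! ### Independence over the subalgebra generated by the net -/

/-- The family `e` is independent modulo the ideal `I`, with coefficients in `R`. -/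
def IndepMod {R A ι : Type*} [CommRing R] [CommRing A] [Fintype ι] (ρ : R →+* A) (I : Ideal A)
    (e : ι → A) : Prop :=
  ∀ c : ι → R, ∑ i, ρ (c i) * e i ∈ I → ∀ i, c i = 0

theorem IndepMod.eval₂ {R A ι : Type*} [CommRing R] [CommRing A] [Fintype ι] {ρ : R →+* A}
    {I : Ideal A} {e : ι → A} {y : A} (hy : ∀ z, y * z ∈ I → z ∈ I)
    (h : IndepMod ρ (I ⊔ Ideal.span {y}) e) : IndepMod (Polynomial.eval₂RingHom ρ y) I e := by
  have step : ∀ c : ι → Polynomial R, ∑ i, Polynomial.eval₂RingHom ρ y (c i) * e i ∈ I →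
      (∀ i, (c i).coeff 0 = 0) ∧
        ∑ i, Polynomial.eval₂RingHom ρ y (c i).divX * e i ∈ I := by
    intro c hc
    have hsplit : ∑ i, Polynomial.eval₂RingHom ρ y (c i) * e i =
        y * ∑ i, Polynomial.eval₂RingHom ρ y (c i).divX * e i +
          ∑ i, ρ ((c i).coeff 0) * e i := by
      rw [Finset.mul_sum, ← Finset.sum_add_distrib]
      refine Finset.sum_congr rfl fun i _ => ?_
      conv_lhs => rw [← Polynomial.X_mul_divX_add (c i)]
      simp only [map_add, map_mul, Polynomial.coe_eval₂RingHom, Polynomial.eval₂_X,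
        Polynomial.eval₂_C]
      ring
    rw [hsplit] at hc
    have h0 : ∀ i, (c i).coeff 0 = 0 := by
      refine h (fun i => (c i).coeff 0) ?_
      have h1 : y * ∑ i, Polynomial.eval₂RingHom ρ y (c i).divX * e i ∈ I ⊔ Ideal.span {y} :=
        Ideal.mul_mem_right _ _ (Ideal.mem_sup_right (Ideal.mem_span_singleton_self y))
      exact (Ideal.add_mem_iff_right _ h1).mp (Ideal.mem_sup_left hc)
    refine ⟨h0, hy _ ?_⟩
    simpa [h0] using hc
  have main : ∀ (N : ℕ) (c : ι → Polynomial R), (∀ i, (c i).natDegree ≤ N) →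
      ∑ i, Polynomial.eval₂RingHom ρ y (c i) * e i ∈ I → ∀ i, c i = 0 := by
    intro N
    induction N with
    | zero =>
      intro c hN hc i
      rw [Polynomial.eq_C_of_natDegree_le_zero (hN i), (step c hc).1 i, map_zero]
    | succ N ih =>
      intro c hN hc i
      obtain ⟨h0, h1⟩ := step c hc
      have h2 := ih (fun i => (c i).divX) (fun i => by
        rw [Polynomial.natDegree_divX_eq_natDegree_tsub_one]
        have := hN i
        omega) h1 i
      rw [← Polynomial.X_mul_divX_add (c i), h2, h0 i]
      simp
  intro c hc
  exact main (∑ i, (c i).natDegree) c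
    (fun i => Finset.single_le_sum (f := fun i => (c i).natDegree) (fun _ _ => Nat.zero_le _)
      (Finset.mem_univ i)) hc

/-- Evaluation of iterated polynomials at three elements of `S`. -/
def evalNet (F₀ F₁ F₂ : S) : Polynomial (Polynomial (Polynomial ℂ)) →+* S :=
  Polynomial.eval₂RingHom (Polynomial.eval₂RingHom (Polynomial.eval₂RingHom C F₀) F₁) F₂

theorem grProj_mem_span_pair {r : ℕ} {γ δ : ℤ × ℤ} {F₁ F₂ p : S} (h₁ : F₁ ∈ Sgr r δ)
    (h₂ : F₂ ∈ Sgr r δ) (hp : p ∈ Ideal.span {F₁, F₂}) :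
    grProj r γ p ∈ Ideal.span {F₁, F₂} := by
  obtain ⟨u, v, rfl⟩ := Ideal.mem_span_pair.mp hp
  rw [map_add, grProj_mul _ h₁, grProj_mul _ h₂]
  exact Ideal.mem_span_pair.mpr ⟨_, _, rfl⟩

theorem IsNet.indepMod_evalNet {r : ℕ} {a b : ℤ} {f F₀ F₁ F₂ : S}
    (hF : IsNet r a b f F₀ F₁ F₂) (hab : (r : ℤ) * b < a) (hb : 0 < b) {j : ℤ}
    (hj : j = 1 ∨ j = 2) {ι : Type*} [Fintype ι] {e : ι → S}
    (he : ∀ i, e i ∈ Sgr r (j * a, j * b))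
    (h : IndepMod C (Ideal.span {F₁, F₂}) e) :
    IndepMod (R := Polynomial (Polynomial (Polynomial ℂ))) (evalNet F₀ F₁ F₂) ⊥ e := by
  have h0 : IndepMod (Polynomial.eval₂RingHom C F₀) (Ideal.span {F₁, F₂}) e := by
    intro c hc i
    ext m
    rw [Polynomial.coeff_zero]
    refine h (fun i => (c i).coeff m) ?_ i
    have hmem : ∑ i, C ((c i).coeff m) * e i ∈ Sgr r (j * a, j * b) :=
      Submodule.sum_mem _ fun i _ => by
        rw [← smul_eq_C_mul]
        exact Submodule.smul_mem _ _ (he i)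
    obtain ⟨s, hs⟩ := hF.pow_mem m
    refine mem_span_pair_of_pow_mul_mem hab hb hj hF.mem₁ hF.mem₂ hF.ne_zero hF.dvd_of_mul_eq
      hmem hs ?_
    have hproj := grProj_mem_span_pair (γ := m • (a, b) + (j * a, j * b)) hF.mem₁ hF.mem₂ hc
    convert hproj using 1
    rw [map_sum, Finset.mul_sum]
    refine Finset.sum_congr rfl fun i _ => ?_
    rw [grProj_mul _ (he i), add_sub_cancel_right, Polynomial.coe_eval₂RingHom,
      Polynomial.eval₂_eq_sum, Polynomial.sum_def, map_sum]
    have hterm : ∀ n, grProj r (m • (a, b)) (C ((c i).coeff n) * F₀ ^ n) =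
        if n = m then C ((c i).coeff n) * F₀ ^ n else 0 := by
      intro n
      have hn : C ((c i).coeff n) * F₀ ^ n ∈ Sgr r (n • (a, b)) := by
        rw [← smul_eq_C_mul]
        exact Submodule.smul_mem _ _ (pow_mem_Sgr hF.mem₀ n)
      split_ifs with hnm
      · subst hnm
        exact grProj_of_mem hn
      · refine grProj_of_mem_of_ne hn fun h' => hnm ?_
        have h2 := congrArg Prod.snd h'
        rw [Prod.smul_snd, Prod.smul_snd, nsmul_eq_mul, nsmul_eq_mul] at h2
        exact_mod_cast mul_right_cancel₀ hb.ne' h2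
    simp only [hterm, Finset.sum_ite_eq']
    split_ifs with hm
    · ring
    · rw [Polynomial.notMem_support_iff.mp hm]
      simp
  have h1 : IndepMod (Polynomial.eval₂RingHom (Polynomial.eval₂RingHom C F₀) F₁)
      (Ideal.span {F₂}) e := by
    refine IndepMod.eval₂ (fun z hz => ?_) ?_
    · obtain ⟨v, hv⟩ := Ideal.mem_span_singleton.mp hz
      exact Ideal.mem_span_singleton.mpr (hF.dvd_of_mul_eq z v hv)
    · rwa [← Ideal.span_union, Set.singleton_union, Set.pair_comm]
  refine IndepMod.eval₂ (fun z hz => ?_) (by rwa [bot_sup_eq])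
  rw [Ideal.mem_bot] at hz ⊢
  exact (mul_eq_zero.mp hz).resolve_left hF.ne_zero

theorem exists_eq_C_of_mem_Sgr_zero {r : ℕ} {p : S} (hp : p ∈ Sgr r 0) : ∃ c : ℂ, p = C c := by
  refine ⟨coeff 0 p, ?_⟩
  ext c
  rw [coeff_C]
  split_ifs with hc
  · rw [hc]
  · by_contra hne
    obtain ⟨h1, h2⟩ := Prod.ext_iff.mp (wdeg_eq_of_coeff_ne_zero hp hne)
    simp only [wdeg, Prod.fst_zero, Prod.snd_zero] at h1 h2
    have h3 : c 3 = 0 := by omega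
    rw [h3] at h1
    simp only [Nat.cast_zero, mul_zero, add_zero] at h1
    refine hc (Finsupp.ext fun i => ?_)
    fin_cases i <;> simp <;> omega

theorem IsNet.coeff_eq_zero_of_mem_span_pair {r : ℕ} {a b : ℤ} {f F₀ F₁ F₂ : S}
    (hF : IsNet r a b f F₀ F₁ F₂) {α : S} {t : ℂ}
    (hα : X 0 * X 1 * X 2 * X 3 * α ∈ Sgr r (a, b))
    (h : X 0 * X 1 * X 2 * X 3 * α + t • F₀ ∈ Ideal.span {F₁, F₂}) :
    t = 0 ∧ X 0 * X 1 * X 2 * X 3 * α = 0 := by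
  obtain ⟨u, hu, v, hv, huv⟩ := exists_homogeneous_pair hF.mem₁ hF.mem₂
    (Submodule.add_mem _ hα (Submodule.smul_mem _ t hF.mem₀)) h
  rw [sub_self] at hu hv
  obtain ⟨c₁, rfl⟩ := exists_eq_C_of_mem_Sgr_zero hu
  obtain ⟨c₂, rfl⟩ := exists_eq_C_of_mem_Sgr_zero hv
  have heq : X 0 * X 1 * X 2 * X 3 * α = (-t) • F₀ + c₁ • F₁ + c₂ • F₂ := by
    simp only [smul_eq_C_mul, map_neg] at huv ⊢
    linear_combination huv
  obtain ⟨ht, h1, h2⟩ := hF.eq_zero α _ _ _ heq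
  refine ⟨by simpa using ht, ?_⟩
  rw [heq, ht, h1, h2]
  simp

theorem IsNet.evalNet_injective {r : ℕ} {a b : ℤ} {f F₀ F₁ F₂ : S}
    (hF : IsNet r a b f F₀ F₁ F₂) (hab : (r : ℤ) * b < a) (hb : 0 < b) :
    Function.Injective (evalNet F₀ F₁ F₂) := by
  have h := hF.indepMod_evalNet hab hb (j := 1) (Or.inl rfl) (ι := Unit) (e := fun _ => F₀)
    (fun _ => by simpa using hF.mem₀) (by
      intro c hc i
      have := (hF.coeff_eq_zero_of_mem_span_pair (α := 0) (t := c ()) (by simp)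
        (by simpa [smul_eq_C_mul] using hc)).1
      exact this)
  rw [injective_iff_map_eq_zero]
  intro p hp
  exact h (fun _ => p) (by simp [hp]) ()

/-! ### The quadratic form attached to a hyperplane of a finite algebra -/

theorem exists_combination_injective {k L ι F : Type*} [Field k] [CommRing L] [Algebra k L]
    [Field F] [Infinite F] [Algebra F k] [CharZero k] [IsDomain L] [FiniteDimensional k L]
    [Fintype ι] (u : ι → L) (V Y : Submodule k L) (huV : ∀ i, ∀ v ∈ V, u i * v ∈ Y)
    (hY : Module.finrank k Y < Module.finrank k L)
    (hdim : Module.finrank k L ≤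
      Module.finrank k V + Module.finrank k (Submodule.span k (Set.range u)))
    (h1 : (1 : L) ∉ V) :
    ∃ t : ι → F, ∀ v ∈ V,
      (∀ v' ∈ V, (∑ i, algebraMap F k (t i) • u i) * v * v' ∈ Y) → v = 0 := by
  have hYtop : Y < ⊤ := lt_top_iff_ne_top.mpr fun h => by
    rw [h, finrank_top] at hY
    exact hY.false
  obtain ⟨φ, hφ, hYφ⟩ := Submodule.exists_le_ker_of_lt_top Y hYtop
  set B : LinearMap.BilinForm k L := (LinearMap.mul k L).compr₂ φ with hB
  have hBapp : ∀ z w, B z w = φ (z * w) := fun z w => rfl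
  have hrefl : B.IsRefl := fun z w h => by
    rw [hBapp, mul_comm]
    exact h
  have hnd : B.Nondegenerate := by
    refine (LinearMap.IsRefl.nondegenerate_iff_separatingLeft hrefl).mpr fun z hz => ?_
    by_contra hz0
    refine hφ (LinearMap.ext fun w => ?_)
    have hinj : Function.Injective (LinearMap.mulLeft k z) := fun p q hpq =>
      mul_left_cancel₀ hz0 hpq
    obtain ⟨y, rfl⟩ := LinearMap.injective_iff_surjective.mp hinj w
    exact hz y
  set P := Submodule.span k (Set.range u) with hP
  have hVP : V ≤ B.orthogonal P := by
    intro v hv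
    rw [LinearMap.BilinForm.mem_orthogonal_iff]
    intro p hp
    change B p v = 0
    induction hp using Submodule.span_induction with
    | mem p hp =>
      obtain ⟨i, rfl⟩ := hp
      exact hYφ (huV i v hv)
    | zero => simp
    | add p q _ _ hp hq => rw [map_add, LinearMap.add_apply, hp, hq, add_zero]
    | smul c p _ hp => rw [map_smul, LinearMap.smul_apply, hp, smul_zero]
  have hVeq : V = B.orthogonal P := by
    refine Submodule.eq_of_le_of_finrank_le hVP ?_
    rw [LinearMap.BilinForm.finrank_orthogonal hnd]
    omega
  obtain ⟨t, ht⟩ := exists_nondegenerate_combination (F := F) φ u V (fun z => by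
    constructor
    · exact fun hz i => hYφ (huV i z hz)
    · intro hz
      rw [hVeq, LinearMap.BilinForm.mem_orthogonal_iff]
      intro p hp
      change B p z = 0
      induction hp using Submodule.span_induction with
      | mem p hp =>
        obtain ⟨i, rfl⟩ := hp
        exact hz i
      | zero => simp
      | add p q _ _ hp hq => rw [map_add, LinearMap.add_apply, hp, hq, add_zero]
      | smul c p _ hp => rw [map_smul, LinearMap.smul_apply, hp, smul_zero]) h1
  exact ⟨t, fun v hv h => ht v hv fun v' hv' => hYφ (h v' hv')⟩

theorem Subalgebra.exists_combination_injective {k L ι F : Type*} [Field k] [Field L]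
    [Algebra k L] [Field F] [Infinite F] [Algebra F k] [CharZero k] [Fintype ι]
    (Λ : Subalgebra k L) [FiniteDimensional k Λ] {u : ι → L} (hu : ∀ i, u i ∈ Λ)
    {V Y : Submodule k L} (hV : V ≤ Subalgebra.toSubmodule Λ) (hYΛ : Y ≤ Subalgebra.toSubmodule Λ)
    (huV : ∀ i, ∀ v ∈ V, u i * v ∈ Y)
    (hY : Module.finrank k Y < Module.finrank k Λ)
    (hdim : Module.finrank k Λ ≤
      Module.finrank k V + Module.finrank k (Submodule.span k (Set.range u)))
    (h1 : (1 : L) ∉ V) :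
    ∃ t : ι → F, ∀ v ∈ V,
      (∀ v' ∈ V, (∑ i, algebraMap F k (t i) • u i) * v * v' ∈ Y) → v = 0 := by
  have hfin : ∀ U : Submodule k L, U ≤ Subalgebra.toSubmodule Λ →
      Module.finrank k (U.comap Λ.val.toLinearMap) = Module.finrank k U := fun U hU =>
    (Submodule.submoduleOfEquivOfLe hU).finrank_eq
  have hspan : (Submodule.span k (Set.range u)).comap Λ.val.toLinearMap =
      Submodule.span k (Set.range fun i => (⟨u i, hu i⟩ : Λ)) := by
    have hinj : Function.Injective Λ.val.toLinearMap := Subtype.val_injective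
    rw [← Submodule.comap_map_eq_of_injective hinj (Submodule.span k _), Submodule.map_span,
      ← Set.range_comp]
    rfl
  have hPΛ : Submodule.span k (Set.range u) ≤ Subalgebra.toSubmodule Λ := by
    rw [Submodule.span_le]
    rintro _ ⟨i, rfl⟩
    exact hu i
  obtain ⟨t, ht⟩ := _root_.exists_combination_injective (F := F) (fun i => (⟨u i, hu i⟩ : Λ))
    (V.comap Λ.val.toLinearMap) (Y.comap Λ.val.toLinearMap)
    (fun i v hv => huV i v hv) (by rwa [hfin Y hYΛ])
    (by rwa [hfin V hV, ← hspan, hfin _ hPΛ]) h1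
  refine ⟨t, fun v hv h => ?_⟩
  have := ht ⟨v, hV hv⟩ hv fun v' hv' => by
    have := h v' hv'
    simpa using this
  exact congrArg Subtype.val this

/-! ### Complex dimensions of pieces of the ideal of the net -/

theorem prod_X_mul_mem_Sgr {r : ℕ} {u v : ℤ} {α : S} (hα : α ∈ Sgr r (u - r - 2, v - 2)) :
    X 0 * X 1 * X 2 * X 3 * α ∈ Sgr r (u, v) := by
  have h : ∀ i, (X i : S) ∈ Sgr r (wdeg r (Finsupp.single i 1)) := fun i => by
    simpa using X_pow_mem_Sgr r i 1
  convert mul_mem_Sgr (mul_mem_Sgr (mul_mem_Sgr (mul_mem_Sgr (h 0) (h 1)) (h 2)) (h 3)) hα using 2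
  ext <;> simp [wdeg]
  ring

theorem prod_X_ne_zero : (X 0 * X 1 * X 2 * X 3 : S) ≠ 0 := by
  simp [X_ne_zero]

namespace IsNet

variable {r : ℕ} {a b : ℤ} {f F₀ F₁ F₂ : S}

theorem ne_zero₀ (hF : IsNet r a b f F₀ F₁ F₂) : F₀ ≠ 0 := by
  rintro h
  have := (hF.eq_zero 0 1 0 0 (by simp [h])).1
  exact one_ne_zero this

theorem finrank_inf_span_pair_le (hF : IsNet r a b f F₀ F₁ F₂) :
    Module.finrank ℂ ↥(Sgr r (a, b) ⊓ (Ideal.span {F₁, F₂}).restrictScalars ℂ) ≤ 2 := by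
  classical
  have hle : Sgr r (a, b) ⊓ (Ideal.span {F₁, F₂}).restrictScalars ℂ ≤
      Submodule.span ℂ (({F₁, F₂} : Finset S) : Set S) := by
    rintro p ⟨hp, hpI⟩
    obtain ⟨u, hu, v, hv, rfl⟩ := exists_homogeneous_pair hF.mem₁ hF.mem₂ hp hpI
    rw [sub_self] at hu hv
    obtain ⟨c, rfl⟩ := exists_eq_C_of_mem_Sgr_zero hu
    obtain ⟨d, rfl⟩ := exists_eq_C_of_mem_Sgr_zero hv
    rw [Finset.coe_pair, Submodule.mem_span_pair]
    exact ⟨c, d, by simp [smul_eq_C_mul]⟩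
  exact (Submodule.finrank_mono hle).trans
    ((finrank_span_finset_le_card _).trans Finset.card_le_two)

theorem finrank_two_inf_span_pair_lt (hF : IsNet r a b f F₀ F₁ F₂) :
    Module.finrank ℂ ↥(Sgr r (2 * a, 2 * b) ⊓ (Ideal.span {F₁, F₂}).restrictScalars ℂ) + 1 ≤
      2 * Module.finrank ℂ (Sgr r (a, b)) := by
  set Φ : Sgr r (a, b) × Sgr r (a, b) →ₗ[ℂ] S :=
    ((LinearMap.mulLeft ℂ F₁).comp (Sgr r (a, b)).subtype).coprod
      ((LinearMap.mulLeft ℂ F₂).comp (Sgr r (a, b)).subtype) with hΦ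
  have hle : Sgr r (2 * a, 2 * b) ⊓ (Ideal.span {F₁, F₂}).restrictScalars ℂ ≤
      LinearMap.range Φ := by
    rintro p ⟨hp, hpI⟩
    obtain ⟨u, hu, v, hv, rfl⟩ := exists_homogeneous_pair hF.mem₁ hF.mem₂ hp hpI
    have hdeg : ((2 * a, 2 * b) - (a, b) : ℤ × ℤ) = (a, b) := by
      ext <;> simp <;> ring
    rw [hdeg] at hu hv
    exact ⟨(⟨u, hu⟩, ⟨v, hv⟩), by simp [hΦ, mul_comm]⟩
  have hker : 0 < Module.finrank ℂ (LinearMap.ker Φ) := by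
    have hz : ((⟨F₂, hF.mem₂⟩, ⟨-F₁, neg_mem hF.mem₁⟩) : Sgr r (a, b) × Sgr r (a, b)) ∈
        LinearMap.ker Φ := by
      rw [LinearMap.mem_ker]
      simp [hΦ, mul_comm]
    have : Nontrivial (LinearMap.ker Φ) := ⟨⟨_, hz⟩, 0, fun h => hF.ne_zero
      (congrArg (fun z : LinearMap.ker Φ => (z.1.1 : S)) h)⟩
    exact Module.finrank_pos (R := ℂ) (M := LinearMap.ker Φ)
  have := Submodule.finrank_mono hle
  have := LinearMap.finrank_range_add_finrank_ker Φ
  rw [Module.finrank_prod] at this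
  omega

theorem eq_zero_of_mem_span_pair (hF : IsNet r a b f F₀ F₁ F₂) {α : S}
    (hα : α ∈ Sgr r (a - r - 2, b - 2))
    (h : X 0 * X 1 * X 2 * X 3 * α ∈ Ideal.span {F₁, F₂}) : α = 0 := by
  have := (hF.coeff_eq_zero_of_mem_span_pair (t := 0) (prod_X_mul_mem_Sgr hα) (by simpa using h)).2
  exact (mul_eq_zero.mp this).resolve_left prod_X_ne_zero

theorem eq_zero_of_combination_eq_zero (hF : IsNet r a b f F₀ F₁ F₂) (hab : (r : ℤ) * b < a)
    (hb : 0 < b) {α₀ α₁ α₂ : S} (h₀ : α₀ ∈ Sgr r (a - r - 2, b - 2))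
    (h₁ : α₁ ∈ Sgr r (a - r - 2, b - 2))
    (h : F₀ * α₀ + F₁ * α₁ + F₂ * α₂ = 0) : α₀ = 0 ∧ α₁ = 0 ∧ α₂ = 0 := by
  have hα₀ : α₀ = 0 := by
    refine hF.eq_zero_of_mem_span_pair h₀ ?_
    obtain ⟨s, hs⟩ := hF.pow_mem 1
    refine mem_span_pair_of_pow_mul_mem hab hb (Or.inl rfl) hF.mem₁ hF.mem₂ hF.ne_zero
      hF.dvd_of_mul_eq (by simpa using prod_X_mul_mem_Sgr h₀) hs
      (Ideal.mem_span_pair.mpr ⟨-(X 0 * X 1 * X 2 * X 3 * α₁), -(X 0 * X 1 * X 2 * X 3 * α₂), ?_⟩)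
    linear_combination (-(X 0 * X 1 * X 2 * X 3)) * h
  subst hα₀
  have hα₁ : α₁ = 0 := by
    obtain ⟨v, rfl⟩ := hF.dvd_of_mul_eq α₁ (-α₂) (by linear_combination h)
    refine hF.eq_zero_of_mem_span_pair h₁ ?_
    exact Ideal.mul_mem_left _ _
      (Ideal.mul_mem_right _ _ (Ideal.subset_span (by simp)))
  subst hα₁
  refine ⟨rfl, rfl, ?_⟩
  simpa [hF.ne_zero] using h

theorem exists_submodule_combination (hF : IsNet r a b f F₀ F₁ F₂) (hab : (r : ℤ) * b < a)
    (hb : 0 < b) :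
    ∃ T ≤ Sgr r (2 * a - r - 2, 2 * b - 2),
      Module.finrank ℂ T = 3 * Module.finrank ℂ (Sgr r (a - r - 2, b - 2)) ∧
      ∀ p ∈ T, ∃ α₀ ∈ Sgr r (a - r - 2, b - 2), ∃ α₁ ∈ Sgr r (a - r - 2, b - 2),
        ∃ α₂ ∈ Sgr r (a - r - 2, b - 2), p = F₀ * α₀ + F₁ * α₁ + F₂ * α₂ := by
  set V := Sgr r (a - r - 2, b - 2) with hV
  set Φ : V × V × V →ₗ[ℂ] S :=
    ((LinearMap.mulLeft ℂ F₀).comp V.subtype).coprod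
      (((LinearMap.mulLeft ℂ F₁).comp V.subtype).coprod
        ((LinearMap.mulLeft ℂ F₂).comp V.subtype)) with hΦ
  have happ : ∀ z, Φ z = F₀ * z.1 + F₁ * z.2.1 + F₂ * z.2.2 := fun z => by
    simp [hΦ, add_assoc]
  refine ⟨LinearMap.range Φ, ?_, ?_, ?_⟩
  · rintro _ ⟨z, rfl⟩
    have hdeg : ((2 * a - r - 2, 2 * b - 2) : ℤ × ℤ) = (a, b) + (a - r - 2, b - 2) := by
      ext <;> simp <;> ring
    rw [happ, hdeg]
    exact add_mem (add_mem (mul_mem_Sgr hF.mem₀ z.1.2) (mul_mem_Sgr hF.mem₁ z.2.1.2))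
      (mul_mem_Sgr hF.mem₂ z.2.2.2)
  · rw [LinearMap.finrank_range_of_inj, Module.finrank_prod, Module.finrank_prod]
    · ring
    · rw [injective_iff_map_eq_zero]
      rintro ⟨z₀, z₁, z₂⟩ hz
      rw [happ] at hz
      obtain ⟨h₀, h₁, h₂⟩ := hF.eq_zero_of_combination_eq_zero hab hb z₀.2 z₁.2 hz
      exact Prod.ext (Subtype.ext h₀) (Prod.ext (Subtype.ext h₁) (Subtype.ext h₂))
  · rintro _ ⟨z, rfl⟩
    exact ⟨z.1, z.1.2, z.2.1, z.2.1.2, z.2.2, z.2.2.2, happ z⟩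

theorem exists_submodule_inf_span_pair_eq_bot (hF : IsNet r a b f F₀ F₁ F₂) :
    ∃ W ≤ Sgr r (a, b), W ⊓ (Ideal.span {F₁, F₂}).restrictScalars ℂ = ⊥ ∧
      Module.finrank ℂ W = Module.finrank ℂ (Sgr r (a - r - 2, b - 2)) + 1 ∧
      ∀ p ∈ W, ∃ α ∈ Sgr r (a - r - 2, b - 2), ∃ t : ℂ,
        p = X 0 * X 1 * X 2 * X 3 * α + t • F₀ := by
  set V := Sgr r (a - r - 2, b - 2) with hV
  set Φ : V × ℂ →ₗ[ℂ] S :=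
    ((LinearMap.mulLeft ℂ (X 0 * X 1 * X 2 * X 3)).comp V.subtype).coprod
      (LinearMap.toSpanSingleton ℂ S F₀) with hΦ
  have happ : ∀ z, Φ z = X 0 * X 1 * X 2 * X 3 * (z.1 : S) + z.2 • F₀ := fun z => by
    simp [hΦ, mul_assoc]
  have hzero : ∀ z, Φ z ∈ Ideal.span {F₁, F₂} → z = 0 := by
    intro z hz
    rw [happ] at hz
    obtain ⟨h1, h2⟩ := hF.coeff_eq_zero_of_mem_span_pair (prod_X_mul_mem_Sgr z.1.2) hz
    exact Prod.ext (Subtype.ext ((mul_eq_zero.mp h2).resolve_left prod_X_ne_zero)) h1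
  refine ⟨LinearMap.range Φ, ?_, ?_, ?_, ?_⟩
  · rintro _ ⟨z, rfl⟩
    rw [happ]
    exact add_mem (prod_X_mul_mem_Sgr z.1.2) (Submodule.smul_mem _ _ hF.mem₀)
  · rw [Submodule.eq_bot_iff]
    rintro _ ⟨⟨z, rfl⟩, hz⟩
    rw [hzero z hz, map_zero]
  · rw [LinearMap.finrank_range_of_inj, Module.finrank_prod, Module.finrank_self]
    rw [injective_iff_map_eq_zero]
    exact fun z hz => hzero z (hz ▸ Ideal.zero_mem _)
  · rintro _ ⟨z, rfl⟩
    exact ⟨z.1, z.1.2, z.2, happ z⟩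

end IsNet

theorem two_mul_finrank_Sgr_nsmul {r : ℕ} {a b : ℤ} (hab : (r : ℤ) * b < a) (hb : 0 < b) (n : ℕ) :
    2 * (Module.finrank ℂ (Sgr r (n • (a, b))) : ℤ) =
      (2 * a * b - r * b ^ 2) * n ^ 2 + (2 * a + 2 * b - r * b) * n + 2 := by
  have h : (n • (a, b) : ℤ × ℤ) = (n * a, n * b) := by
    ext <;> simp
  rw [h, two_mul_finrank_Sgr (by positivity)]
  · ring
  · nlinarith [mul_nonneg (Int.natCast_nonneg n) (sub_nonneg.mpr hab.le)]

/-! ### Extension to the function field of the net -/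

/-- The subalgebra generated by three polynomials. -/
abbrev netRing (F₀ F₁ F₂ : S) : Subalgebra ℂ S :=
  Algebra.adjoin ℂ {F₀, F₁, F₂}

theorem exists_evalNet_eq {F₀ F₁ F₂ p : S} (hp : p ∈ netRing F₀ F₁ F₂) :
    ∃ q, evalNet F₀ F₁ F₂ q = p := by
  induction hp using Algebra.adjoin_induction with
  | mem p hp =>
    rcases hp with rfl | rfl | rfl
    · exact ⟨Polynomial.C (Polynomial.C Polynomial.X), by simp [evalNet]⟩
    · exact ⟨Polynomial.C Polynomial.X, by simp [evalNet]⟩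
    · exact ⟨Polynomial.X, by simp [evalNet]⟩
  | algebraMap c =>
    exact ⟨Polynomial.C (Polynomial.C (Polynomial.C c)), by simp [evalNet, algebraMap_eq]⟩
  | add p q _ _ hp hq =>
    obtain ⟨p', rfl⟩ := hp
    obtain ⟨q', rfl⟩ := hq
    exact ⟨p' + q', map_add _ _ _⟩
  | mul p q _ _ hp hq =>
    obtain ⟨p', rfl⟩ := hp
    obtain ⟨q', rfl⟩ := hq
    exact ⟨p' * q', map_mul _ _ _⟩

theorem Submodule.exists_independent_mod {k M : Type*} [Field k] [AddCommGroup M] [Module k M]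
    (W I : Submodule k M) [FiniteDimensional k W] :
    ∃ (n : ℕ) (e : Fin n → M), (∀ i, e i ∈ W) ∧
      Module.finrank k ↥(W ⊓ I) + n = Module.finrank k W ∧
      ∀ c : Fin n → k, ∑ i, c i • e i ∈ I → ∀ i, c i = 0 := by
  obtain ⟨Q, hQ⟩ := (I.comap W.subtype).exists_isCompl
  refine ⟨Module.finrank k Q, fun i => ((Module.finBasis k Q i : W) : M), fun i => Subtype.prop _,
    ?_, fun c hc => ?_⟩
  · rw [← Submodule.finrank_add_eq_of_isCompl hQ,
      ← Submodule.finrank_map_subtype_eq W (I.comap W.subtype), Submodule.map_comap_subtype]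
  · have hsum : ∑ i, c i • ((Module.finBasis k Q i : W) : M) =
        (((∑ i, c i • Module.finBasis k Q i : Q) : W) : M) := by
      simp
    rw [hsum] at hc
    have hzero := Submodule.disjoint_def.mp hQ.disjoint
      ((∑ i, c i • Module.finBasis k Q i : Q) : W) hc (Subtype.prop _)
    exact Fintype.linearIndependent_iff.mp (Module.finBasis k Q).linearIndependent c
      (Subtype.ext hzero)

section FunctionField

variable {K L : Type*} [Field K] [Field L] [Algebra K L] [Algebra S L]

variable (K L) in
/-- The `K`-span of the image of a space of polynomials. -/
def netSpan (W : Submodule ℂ S) : Submodule K L :=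
  Submodule.span K (algebraMap S L '' W)

theorem mem_netSpan {W : Submodule ℂ S} {p : S} (hp : p ∈ W) : algebraMap S L p ∈ netSpan K L W :=
  Submodule.subset_span ⟨p, hp, rfl⟩

theorem IndepMod.linearIndependent {F₀ F₁ F₂ : S} [FaithfulSMul S L]
    [Algebra (netRing F₀ F₁ F₂) K] [IsScalarTower (netRing F₀ F₁ F₂) K L]
    [IsFractionRing (netRing F₀ F₁ F₂) K] {ι : Type*} [Fintype ι]
    {e : ι → S} (h : IndepMod (R := Polynomial (Polynomial (Polynomial ℂ)))
      (evalNet F₀ F₁ F₂) ⊥ e) :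
    LinearIndependent K (algebraMap S L ∘ e) := by
  rw [← LinearIndependent.iff_fractionRing (netRing F₀ F₁ F₂) K, Fintype.linearIndependent_iff]
  intro c hc
  choose d hd using fun i => exists_evalNet_eq (c i).2
  have hd0 := h d (by
    rw [Ideal.mem_bot]
    apply FaithfulSMul.algebraMap_injective S L
    rw [map_zero, ← hc, map_sum]
    refine Finset.sum_congr rfl fun i _ => ?_
    rw [hd, map_mul, Algebra.smul_def]
    rfl)
  intro i
  refine Subtype.ext ?_
  rw [← hd i, hd0 i, map_zero, ZeroMemClass.coe_zero]

variable [Algebra ℂ K] [Algebra ℂ L] [IsScalarTower ℂ K L] [IsScalarTower ℂ S L]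

theorem netSpan_span (s : Set S) :
    netSpan K L (Submodule.span ℂ s) = Submodule.span K (algebraMap S L '' s) := by
  have h : algebraMap S L '' (Submodule.span ℂ s : Set S) =
      Submodule.span ℂ (algebraMap S L '' s) := by
    have := congrArg (fun M : Submodule ℂ L => (M : Set L))
      (Submodule.map_span (IsScalarTower.toAlgHom ℂ S L).toLinearMap s)
    simpa using this
  rw [netSpan, h, Submodule.span_span_of_tower]

theorem netSpan_eq_span_range (W : Submodule ℂ S) [FiniteDimensional ℂ W] :
    netSpan K L W =
      Submodule.span K (Set.range fun i => algebraMap S L (Module.finBasis ℂ W i : S)) := by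
  have h : Submodule.span ℂ (Set.range fun i => (Module.finBasis ℂ W i : S)) = W := by
    have h1 := congrArg (Submodule.map W.subtype) (Module.finBasis ℂ W).span_eq
    rw [Submodule.map_span, ← Set.range_comp, Submodule.map_subtype_top] at h1
    exact h1
  conv_lhs => rw [← h]
  rw [netSpan_span, ← Set.range_comp]
  rfl

theorem finite_netSpan (W : Submodule ℂ S) [FiniteDimensional ℂ W] :
    FiniteDimensional K (netSpan K L W) ∧
      Module.finrank K (netSpan K L W) ≤ Module.finrank ℂ W := by
  rw [netSpan_eq_span_range]
  refine ⟨FiniteDimensional.span_of_finite K (Set.finite_range _), ?_⟩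
  simpa [Set.finrank] using finrank_range_le_card (R := K)
    fun i => algebraMap S L (Module.finBasis ℂ W i : S)

instance (W : Submodule ℂ S) [FiniteDimensional ℂ W] : FiniteDimensional K (netSpan K L W) :=
  (finite_netSpan W).1

variable {F₀ F₁ F₂ f : S} {r : ℕ} {a b : ℤ} [FaithfulSMul S L] [Algebra (netRing F₀ F₁ F₂) K]
  [IsScalarTower (netRing F₀ F₁ F₂) K L] [IsFractionRing (netRing F₀ F₁ F₂) K]

theorem IsNet.finrank_le_finrank_netSpan (hF : IsNet r a b f F₀ F₁ F₂) (hab : (r : ℤ) * b < a)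
    (hb : 0 < b) {i : ℤ} (hi : i = 1 ∨ i = 2)
    {W : Submodule ℂ S} (hW : W ≤ Sgr r (i * a, i * b)) :
    Module.finrank ℂ W ≤ Module.finrank K (netSpan K L W) +
      Module.finrank ℂ ↥(W ⊓ (Ideal.span {F₁, F₂}).restrictScalars ℂ) := by
  have hWfin : FiniteDimensional ℂ W := Submodule.finiteDimensional_of_le hW
  set I := (Ideal.span {F₁, F₂}).restrictScalars ℂ with hI
  obtain ⟨n, e, heW, hn, he⟩ := W.exists_independent_mod I
  have hindep : IndepMod C (Ideal.span {F₁, F₂}) e := fun c hc =>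
    he c (by simpa [smul_eq_C_mul, hI] using hc)
  have hnet := hF.indepMod_evalNet hab hb hi (fun i => hW (heW i)) hindep
  have hK : LinearIndependent K (algebraMap S L ∘ e) := hnet.linearIndependent
  have hle : Submodule.span K (Set.range (algebraMap S L ∘ e)) ≤ netSpan K L W := by
    rw [Submodule.span_le]
    rintro _ ⟨i, rfl⟩
    exact mem_netSpan (heW i)
  have h1 := Submodule.finrank_mono hle
  rw [finrank_span_eq_card hK, Fintype.card_fin] at h1
  omega

end FunctionField

/-! ### The finite algebra attached to the net -/

namespace IsNet

variable {F₀ F₁ F₂ f : S} {r : ℕ} {a b : ℤ}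

theorem linearIndependent_monomials (hF : IsNet r a b f F₀ F₁ F₂) (hab : (r : ℤ) * b < a)
    (hb : 0 < b) (n : ℕ) :
    LinearIndependent ℂ fun s : (Σ i : Fin (n + 1), Fin (i + 1)) =>
      F₀ ^ (n - s.1 : ℕ) * F₁ ^ (s.1 - s.2 : ℕ) * F₂ ^ (s.2 : ℕ) := by
  rw [Fintype.linearIndependent_iff]
  intro c hc s₀
  set q : Polynomial (Polynomial (Polynomial ℂ)) := ∑ s : (Σ i : Fin (n + 1), Fin (i + 1)),
    Polynomial.monomial (s.2 : ℕ) (Polynomial.monomial (s.1 - s.2 : ℕ)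
      (Polynomial.monomial (n - s.1 : ℕ) (c s))) with hq
  have hq0 : q = 0 := by
    apply hF.evalNet_injective hab hb
    rw [map_zero, ← hc, hq, map_sum]
    refine Finset.sum_congr rfl fun s _ => ?_
    simp only [evalNet, Polynomial.coe_eval₂RingHom, Polynomial.eval₂_monomial, smul_eq_C_mul]
    ring
  have h0 : ((q.coeff s₀.2).coeff (s₀.1 - s₀.2 : ℕ)).coeff (n - s₀.1 : ℕ) = 0 := by
    simp [hq0]
  rw [hq, Polynomial.finsetSum_coeff, Polynomial.finsetSum_coeff, Polynomial.finsetSum_coeff,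
    Finset.sum_eq_single s₀] at h0
  · simpa using h0
  · intro s _ hs
    simp only [Polynomial.coeff_monomial]
    split_ifs with h1
    · simp only [Polynomial.coeff_monomial]
      split_ifs with h2
      · simp only [Polynomial.coeff_monomial]
        split_ifs with h3
        · refine absurd ?_ hs
          obtain ⟨i, k⟩ := s
          obtain ⟨i₀, k₀⟩ := s₀
          obtain rfl : i = i₀ := Fin.ext (by simp only at h3; omega)
          obtain rfl : k = k₀ := Fin.ext h1
          rfl
        · rfl
      · simp
    · simp
  · simp

theorem monomials_mem_Sgr (hF : IsNet r a b f F₀ F₁ F₂) (n : ℕ)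
    (s : Σ i : Fin (n + 1), Fin (i + 1)) :
    F₀ ^ (n - s.1 : ℕ) * F₁ ^ (s.1 - s.2 : ℕ) * F₂ ^ (s.2 : ℕ) ∈ Sgr r (n • (a, b)) := by
  have h : n • (a, b) = (n - s.1 : ℕ) • (a, b) + (s.1 - s.2 : ℕ) • (a, b) + (s.2 : ℕ) • (a, b) := by
    rw [← add_smul, ← add_smul]
    congr 1
    omega
  rw [h]
  exact mul_mem_Sgr (mul_mem_Sgr (pow_mem_Sgr hF.mem₀ _) (pow_mem_Sgr hF.mem₁ _))
    (pow_mem_Sgr hF.mem₂ _)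

end IsNet

theorem two_mul_card_monomials (n : ℕ) :
    2 * Fintype.card (Σ i : Fin (n + 1), Fin (i + 1)) = (n + 1) * (n + 2) := by
  rw [Fintype.card_sigma]
  simp only [Fintype.card_fin]
  rw [Fin.sum_univ_eq_sum_range (fun i => i + 1) (n + 1)]
  induction n with
  | zero => simp
  | succ n ih =>
    rw [Finset.sum_range_succ, mul_add, ih]
    ring

theorem le_of_forall_mul_le {m N τ d : ℤ} (hN : 0 ≤ N) (hτ : 0 ≤ τ) (hd : 0 ≤ d)
    (h : ∀ n : ℕ, m * ((n + 1) * (n + 2)) ≤ N * (n + d) ^ 2 + τ * (n + d) + 2) : m ≤ N := by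
  by_contra! hlt
  obtain ⟨n, hn⟩ := Int.eq_ofNat_of_zero_le
    (a := 2 * N * d + τ + N * d ^ 2 + τ * d + 3) (by positivity)
  have h1 := h n
  have hn0 : (0 : ℤ) ≤ n := Int.natCast_nonneg n
  have h2 : (N + 1) * (((n : ℤ) + 1) * (n + 2)) ≤ m * ((n + 1) * (n + 2)) :=
    mul_le_mul_of_nonneg_right hlt (by positivity)
  have h3 : (n : ℤ) * n = n * (2 * N * d + τ) + n * (N * d ^ 2 + τ * d + 3) := by
    rw [← mul_add]
    congr 1
    rw [← hn]
    ring
  have h4 : N * d ^ 2 + τ * d + 3 ≤ n * (N * d ^ 2 + τ * d + 3) :=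
    le_mul_of_one_le_left (by positivity) (by
      rw [← hn]
      nlinarith [mul_nonneg (mul_nonneg zero_le_two hN) hd, mul_nonneg hN (sq_nonneg d),
        mul_nonneg hτ hd])
  nlinarith [mul_nonneg hN hn0]

section FunctionField

variable {K L : Type*} [Field K] [Field L] [Algebra K L] [Algebra S L]
  {F₀ F₁ F₂ f : S} {r : ℕ} {a b : ℤ}

theorem IsNet.card_le_of_linearIndependent (hF : IsNet r a b f F₀ F₁ F₂) (hab : (r : ℤ) * b < a)
    (hb : 0 < b) [Algebra (netRing F₀ F₁ F₂) K] [IsScalarTower (netRing F₀ F₁ F₂) K L]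
    [IsFractionRing (netRing F₀ F₁ F₂) K] {ι : Type*} [Fintype ι]
    {p : ι → S} {n : ι → ℕ} (hp : ∀ l, p l ∈ Sgr r (n l • (a, b)))
    (h : LinearIndependent K (algebraMap S L ∘ p)) :
    (Fintype.card ι : ℤ) ≤ 2 * a * b - r * b ^ 2 := by
  have hRp : LinearIndependent (netRing F₀ F₁ F₂) p := by
    rw [← LinearIndependent.iff_fractionRing (netRing F₀ F₁ F₂) K] at h
    exact h.of_comp (IsScalarTower.toAlgHom (netRing F₀ F₁ F₂) S L).toLinearMap
  have h₀ : F₀ ∈ netRing F₀ F₁ F₂ := Algebra.subset_adjoin (by simp)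
  have h₁ : F₁ ∈ netRing F₀ F₁ F₂ := Algebra.subset_adjoin (by simp)
  have h₂ : F₂ ∈ netRing F₀ F₁ F₂ := Algebra.subset_adjoin (by simp)
  set d := ∑ l, n l with hd
  have hnd : ∀ l, n l ≤ d := fun l =>
    Finset.single_le_sum (f := n) (fun _ _ => Nat.zero_le _) (Finset.mem_univ l)
  have hRp' : LinearIndependent (netRing F₀ F₁ F₂) fun l => F₀ ^ (d - n l) * p l := by
    rw [Fintype.linearIndependent_iff] at hRp ⊢
    intro c hc l
    have h0 := hRp (fun l => c l * ⟨F₀, h₀⟩ ^ (d - n l)) (by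
      rw [← hc]
      refine Finset.sum_congr rfl fun l _ => ?_
      simp [Algebra.smul_def, mul_assoc]) l
    refine (mul_eq_zero.mp h0).resolve_right (pow_ne_zero _ fun h' => hF.ne_zero₀ ?_)
    exact congrArg Subtype.val h'
  refine le_of_forall_mul_le (τ := 2 * a + 2 * b - r * b) (d := d) ?_ ?_ (by positivity)
    fun m => ?_
  · nlinarith
  · nlinarith
  have hM : LinearIndependent ℂ fun s : (Σ i : Fin (m + 1), Fin (i + 1)) =>
      (⟨F₀ ^ (m - s.1 : ℕ) * F₁ ^ (s.1 - s.2 : ℕ) * F₂ ^ (s.2 : ℕ),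
        mul_mem (mul_mem (_root_.pow_mem h₀ _) (_root_.pow_mem h₁ _)) (_root_.pow_mem h₂ _)⟩ :
        netRing F₀ F₁ F₂) :=
    (hF.linearIndependent_monomials hab hb m).of_comp (netRing F₀ F₁ F₂).val.toLinearMap
  have hprod := linearIndependent_smul hM hRp'
  have hmem : ∀ s : (Σ i : Fin (m + 1), Fin (i + 1)) × ι,
      F₀ ^ (m - s.1.1 : ℕ) * F₁ ^ (s.1.1 - s.1.2 : ℕ) * F₂ ^ (s.1.2 : ℕ) *
        (F₀ ^ (d - n s.2) * p s.2) ∈ Sgr r ((m + d) • (a, b)) := by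
    intro s
    have hdeg : (m + d) • (a, b) = m • (a, b) + ((d - n s.2) • (a, b) + n s.2 • (a, b)) := by
      rw [← add_smul, Nat.sub_add_cancel (hnd _), ← add_smul]
    rw [hdeg]
    exact mul_mem_Sgr (hF.monomials_mem_Sgr m s.1)
      (mul_mem_Sgr (pow_mem_Sgr hF.mem₀ _) (hp _))
  have hSgr : LinearIndependent ℂ fun s => (⟨_, hmem s⟩ : Sgr r ((m + d) • (a, b))) :=
    LinearIndependent.of_comp (Sgr r ((m + d) • (a, b))).subtype hprod
  have hcard := hSgr.fintype_card_le_finrank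
  rw [Fintype.card_prod] at hcard
  have h2 := two_mul_card_monomials m
  have h3 := two_mul_finrank_Sgr_nsmul hab hb (m + d)
  zify at hcard h2
  push_cast at h3
  rw [← h2, ← h3]
  linarith

end FunctionField

theorem Submodule.exists_sup_eq_finrank {k M : Type*} [Field k] [AddCommGroup M] [Module k M]
    {T D : Submodule k M} [FiniteDimensional k D] (hT : T ≤ D) :
    ∃ Q ≤ D, T ⊔ Q = D ∧ Module.finrank k T + Module.finrank k Q = Module.finrank k D := by
  obtain ⟨Q, hdisj, hsup⟩ := exists_isCompl T |>.elim fun P hP =>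
    (⟨P ⊓ D, hP.disjoint.mono_right inf_le_left, by
      rw [← sup_inf_assoc_of_le _ hT, hP.sup_eq_top, top_inf_eq]⟩ :
      ∃ Q, Disjoint T Q ∧ T ⊔ Q = D)
  have hQ : Q ≤ D := hsup ▸ le_sup_right
  have := Submodule.finiteDimensional_of_le hT
  have := Submodule.finiteDimensional_of_le hQ
  refine ⟨Q, hQ, hsup, ?_⟩
  rw [← Submodule.finrank_sup_add_finrank_inf_eq, hsup, hdisj.eq_bot, finrank_bot, add_zero]

section FunctionField

variable {K L : Type*} [Field K] [Field L] [Algebra K L] [Algebra S L]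

variable (K L) in
/-- The `K`-algebra generated by the polynomials of degree a multiple of `(a, b)`. -/
def netAlgebra (r : ℕ) (a b : ℤ) : Subalgebra K L :=
  Algebra.adjoin K (algebraMap S L '' {p | ∃ n : ℕ, p ∈ Sgr r (n • (a, b))})

theorem toSubmodule_netAlgebra (r : ℕ) (a b : ℤ) :
    Subalgebra.toSubmodule (netAlgebra K L r a b) =
      Submodule.span K (algebraMap S L '' {p | ∃ n : ℕ, p ∈ Sgr r (n • (a, b))}) := by
  let G : Submonoid S :=
    { carrier := {p | ∃ n : ℕ, p ∈ Sgr r (n • (a, b))}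
      one_mem' := ⟨0, by simpa using one_mem_Sgr r⟩
      mul_mem' := by
        rintro p q ⟨n, hn⟩ ⟨m, hm⟩
        exact ⟨n + m, by rw [add_smul]; exact mul_mem_Sgr hn hm⟩ }
  have h := Algebra.adjoin_eq_span K ((G.map (algebraMap S L) : Submonoid L) : Set L)
  rwa [Submonoid.closure_eq] at h

theorem netSpan_le_netAlgebra {r : ℕ} {a b : ℤ} {W : Submodule ℂ S} (n : ℕ)
    (hW : W ≤ Sgr r (n * a, n * b)) :
    netSpan K L W ≤ Subalgebra.toSubmodule (netAlgebra K L r a b) := by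
  refine Submodule.span_le.mpr ?_
  rintro _ ⟨p, hp, rfl⟩
  refine Algebra.subset_adjoin ⟨p, ⟨n, ?_⟩, rfl⟩
  have h : (n • (a, b) : ℤ × ℤ) = (n * a, n * b) := by
    ext <;> simp
  rw [h]
  exact hW hp

variable {F₀ F₁ F₂ f : S} {r : ℕ} {a b : ℤ}

theorem IsNet.finite_netAlgebra (hF : IsNet r a b f F₀ F₁ F₂) (hab : (r : ℤ) * b < a)
    (hb : 0 < b) [Algebra (netRing F₀ F₁ F₂) K] [IsScalarTower (netRing F₀ F₁ F₂) K L]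
    [IsFractionRing (netRing F₀ F₁ F₂) K] :
    FiniteDimensional K (netAlgebra K L r a b) ∧
      (Module.finrank K (netAlgebra K L r a b) : ℤ) ≤ 2 * a * b - r * b ^ 2 := by
  set G := algebraMap S L '' {p | ∃ n : ℕ, p ∈ Sgr r (n • (a, b))} with hG
  obtain ⟨B, hBG, hBspan, hB⟩ := exists_linearIndependent K G
  have hbound : ∀ t : Finset L, (t : Set L) ⊆ B → (t.card : ℤ) ≤ 2 * a * b - r * b ^ 2 := by
    intro t ht
    choose p hp hpz using fun z : t => (hBG (ht z.2) : (z : L) ∈ G)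
    choose n hn using hp
    have hli : LinearIndependent K (algebraMap S L ∘ p) := by
      have h1 := hB.comp (fun z : t => (⟨z, ht z.2⟩ : B)) fun z w h =>
        Subtype.ext (congrArg (fun y : B => (y : L)) h)
      rwa [show algebraMap S L ∘ p = Subtype.val ∘ fun z : t => (⟨z, ht z.2⟩ : B) from funext hpz]
    simpa using hF.card_le_of_linearIndependent hab hb hn hli
  have hBfin : B.Finite := by
    by_contra hinf
    obtain ⟨t, ht, hcard⟩ := Set.Infinite.exists_subset_card_eq hinf
      ((2 * a * b - r * b ^ 2).toNat + 1)
    have := hbound t ht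
    omega
  have hspan : Subalgebra.toSubmodule (netAlgebra K L r a b) = Submodule.span K B := by
    rw [toSubmodule_netAlgebra, hBspan]
  have hfin : FiniteDimensional K (Subalgebra.toSubmodule (netAlgebra K L r a b)) := by
    rw [hspan]
    exact FiniteDimensional.span_of_finite K hBfin
  refine ⟨hfin, ?_⟩
  have := hBfin.fintype
  have hrank : Module.finrank K (netAlgebra K L r a b) = B.toFinset.card := by
    rw [← finrank_span_set_eq_card hB, ← hspan]
    rfl
  rw [hrank]
  exact hbound _ (by simp)

variable (F₀ F₁ F₂) in
theorem algebraMap_mul_mem [Algebra (netRing F₀ F₁ F₂) K]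
    [IsScalarTower (netRing F₀ F₁ F₂) K L] {F : S} (hF : F ∈ ({F₀, F₁, F₂} : Set S))
    {Y : Submodule K L} {y : L} (hy : y ∈ Y) : algebraMap S L F * y ∈ Y := by
  have h : algebraMap K L (algebraMap (netRing F₀ F₁ F₂) K ⟨F, Algebra.subset_adjoin hF⟩) =
      algebraMap S L F := by
    rw [← IsScalarTower.algebraMap_apply]
    rfl
  rw [← h, ← Algebra.smul_def]
  exact Y.smul_mem _ hy

/-- The space of multiples of `x₁x₂x₃x₄` by polynomials of degree `γ`. -/
def prodXMul (r : ℕ) (γ : ℤ × ℤ) : Submodule ℂ S :=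
  (Sgr r γ).map (LinearMap.mulLeft ℂ (X 0 * X 1 * X 2 * X 3))

instance (r : ℕ) (γ : ℤ × ℤ) : FiniteDimensional ℂ (prodXMul r γ) :=
  Module.Finite.map _ _

theorem mul_mem_Sgr_two {p α : S} (hp : p ∈ Sgr r (a, b)) (hα : α ∈ Sgr r (a - r - 2, b - 2)) :
    p * α ∈ Sgr r (2 * a - r - 2, 2 * b - 2) := by
  have h : ((a, b) + (a - r - 2, b - 2) : ℤ × ℤ) = (2 * a - r - 2, 2 * b - 2) := by
    ext <;> simp <;> ring
  exact h ▸ mul_mem_Sgr hp hα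

theorem mem_prodXMul {γ : ℤ × ℤ} {α : S} (hα : α ∈ Sgr r γ) :
    X 0 * X 1 * X 2 * X 3 * α ∈ prodXMul r γ :=
  ⟨α, hα, rfl⟩

theorem prodXMul_le {u v : ℤ} : prodXMul r (u - r - 2, v - 2) ≤ Sgr r (u, v) := by
  rintro _ ⟨α, hα, rfl⟩
  exact prod_X_mul_mem_Sgr hα

variable [Algebra ℂ K] [Algebra ℂ L] [IsScalarTower ℂ K L] [IsScalarTower ℂ S L]

theorem finrank_netSpan_map_le (W : Submodule ℂ S) [FiniteDimensional ℂ W] (φ : S →ₗ[ℂ] S) :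
    Module.finrank K (netSpan K L (W.map φ)) ≤ Module.finrank ℂ W :=
  (finite_netSpan _).2.trans (Submodule.finrank_map_le φ W)

variable [Algebra (netRing F₀ F₁ F₂) K] [IsScalarTower (netRing F₀ F₁ F₂) K L]

/-- The span of the multiples of `x₁x₂x₃x₄` of degree `2β` is small, since the net acts on it by
scalars. -/
theorem IsNet.finrank_netSpan_prodXMul_two_le (hF : IsNet r a b f F₀ F₁ F₂)
    (hab : (r : ℤ) * b < a) (hb : 0 < b) :
    Module.finrank K (netSpan K L (prodXMul r (2 * a - r - 2, 2 * b - 2))) +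
      2 * Module.finrank ℂ (Sgr r (a - r - 2, b - 2)) ≤
        Module.finrank ℂ (Sgr r (2 * a - r - 2, 2 * b - 2)) := by
  obtain ⟨T, hT, hTrank, hTmem⟩ := hF.exists_submodule_combination hab hb
  obtain ⟨Q, hQ, hsup, hrank⟩ := Submodule.exists_sup_eq_finrank hT
  have hQfin : FiniteDimensional ℂ Q := Submodule.finiteDimensional_of_le hQ
  set V := netSpan K L (prodXMul r (a - r - 2, b - 2)) with hV
  set Q' := netSpan K L (Q.map (LinearMap.mulLeft ℂ (X 0 * X 1 * X 2 * X 3))) with hQ'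
  have hmem : ∀ F ∈ ({F₀, F₁, F₂} : Set S), ∀ α ∈ Sgr r (a - r - 2, b - 2),
      algebraMap S L (X 0 * X 1 * X 2 * X 3 * (F * α)) ∈ V := fun F hF α hα => by
    rw [mul_left_comm, map_mul]
    exact algebraMap_mul_mem F₀ F₁ F₂ hF (mem_netSpan (mem_prodXMul hα))
  have hle : netSpan K L (prodXMul r (2 * a - r - 2, 2 * b - 2)) ≤ V ⊔ Q' := by
    refine Submodule.span_le.mpr ?_
    rintro _ ⟨_, ⟨p, hp, rfl⟩, rfl⟩
    rw [← hsup] at hp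
    obtain ⟨t, ht, q, hq, rfl⟩ := Submodule.mem_sup.mp hp
    obtain ⟨α₀, h₀, α₁, h₁, α₂, h₂, rfl⟩ := hTmem t ht
    rw [SetLike.mem_coe, map_add, map_add, LinearMap.mulLeft_apply, mul_add, mul_add, map_add,
      map_add]
    exact add_mem (Submodule.mem_sup_left (add_mem (add_mem (hmem _ (by simp) _ h₀)
      (hmem _ (by simp) _ h₁)) (hmem _ (by simp) _ h₂)))
      (Submodule.mem_sup_right (mem_netSpan ⟨q, hq, rfl⟩))
  have h1 := Submodule.finrank_mono hle
  have h2 := Submodule.finrank_add_le_finrank_add_finrank V Q'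
  have h3 : Module.finrank K V ≤ _ := finrank_netSpan_map_le (K := K) (L := L)
    (Sgr r (a - r - 2, b - 2)) _
  have h4 : Module.finrank K Q' ≤ _ := finrank_netSpan_map_le (K := K) (L := L) Q _
  omega

variable [FaithfulSMul S L] [IsFractionRing (netRing F₀ F₁ F₂) K]

theorem IsNet.le_finrank_netAlgebra (hF : IsNet r a b f F₀ F₁ F₂) (hab : (r : ℤ) * b < a)
    (hb : 0 < b) :
    2 * a * b - r * b ^ 2 ≤ (Module.finrank K (netAlgebra K L r a b) : ℤ) := by
  have := (hF.finite_netAlgebra (K := K) (L := L) hab hb).1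
  have h1 := hF.finrank_le_finrank_netSpan (K := K) (L := L) hab hb (Or.inr rfl)
    (W := Sgr r (2 * a, 2 * b)) le_rfl
  have h2 : Module.finrank K (netSpan K L (Sgr r (2 * a, 2 * b))) ≤
      Module.finrank K (netAlgebra K L r a b) :=
    LinearMap.finrank_le_finrank_of_injective
      (Submodule.inclusion_injective (netSpan_le_netAlgebra 2 (by simp)))
  have h3 := hF.finrank_two_inf_span_pair_lt
  have h4 := two_mul_finrank_Sgr (r := r) (u := a) (v := b) hb.le (by linarith)
  have h5 := two_mul_finrank_Sgr (r := r) (u := 2 * a) (v := 2 * b) (by linarith) (by linarith)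
  zify at h1 h2 h3
  linarith

theorem IsNet.finrank_le_finrank_netSpan_prodXMul (hF : IsNet r a b f F₀ F₁ F₂)
    (hab : (r : ℤ) * b < a) (hb : 0 < b) :
    Module.finrank ℂ (Sgr r (a - r - 2, b - 2)) ≤
        Module.finrank K (netSpan K L (prodXMul r (a - r - 2, b - 2))) ∧
      (1 : L) ∉ netSpan K L (prodXMul r (a - r - 2, b - 2)) := by
  obtain ⟨W, hW, hWI, hWrank, hWmem⟩ := hF.exists_submodule_inf_span_pair_eq_bot
  have h1 := hF.finrank_le_finrank_netSpan (K := K) (L := L) hab hb (Or.inl rfl)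
    (W := W) (by simpa using hW)
  rw [hWI, finrank_bot, add_zero, hWrank] at h1
  have hle : netSpan K L W ≤
      netSpan K L (prodXMul r (a - r - 2, b - 2)) ⊔ Submodule.span K {1} := by
    refine Submodule.span_le.mpr ?_
    rintro _ ⟨p, hp, rfl⟩
    obtain ⟨α, hα, t, rfl⟩ := hWmem p hp
    rw [SetLike.mem_coe, map_add, smul_eq_C_mul, mul_comm (C t), map_mul _ F₀]
    refine add_mem (Submodule.mem_sup_left (mem_netSpan (mem_prodXMul hα)))
      (Submodule.mem_sup_right (algebraMap_mul_mem F₀ F₁ F₂ (by simp) ?_))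
    rw [← algebraMap_eq, ← IsScalarTower.algebraMap_apply, IsScalarTower.algebraMap_apply ℂ K L,
      Algebra.algebraMap_eq_smul_one]
    exact Submodule.smul_mem _ _ (Submodule.mem_span_singleton_self 1)
  have h2 := h1.trans (Submodule.finrank_mono hle)
  refine ⟨?_, fun hmem => ?_⟩
  · have h3 := Submodule.finrank_add_le_finrank_add_finrank
      (netSpan K L (prodXMul r (a - r - 2, b - 2))) (Submodule.span K {(1 : L)})
    have h4 := finrank_span_singleton (K := K) (one_ne_zero (α := L))
    omega
  · rw [sup_eq_left.mpr ((Submodule.span_singleton_le_iff_mem _ _).mpr hmem)] at h2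
    have h3 := finrank_netSpan_map_le (K := K) (L := L) (Sgr r (a - r - 2, b - 2))
      (LinearMap.mulLeft ℂ (X 0 * X 1 * X 2 * X 3))
    have h4 := h2.trans h3
    omega

theorem IsNet.exists_injective (hF : IsNet r a b f F₀ F₁ F₂) (hab : (r : ℤ) * b < a)
    (hb : 0 < b) (habK : (r : ℤ) * (b - 2) < a - r - 2) (hbK : 2 < b)
    (K L : Type*) [Field K] [Field L] [Algebra K L] [Algebra S L] [Algebra ℂ K] [Algebra ℂ L]
    [IsScalarTower ℂ K L] [IsScalarTower ℂ S L] [Algebra (netRing F₀ F₁ F₂) K]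
    [IsScalarTower (netRing F₀ F₁ F₂) K L] [FaithfulSMul S L]
    [IsFractionRing (netRing F₀ F₁ F₂) K] :
    ∃ η ∈ Sgr r (a, b), ∀ α ∈ Sgr r (a - r - 2, b - 2), η * α ∈ J1 f → α = 0 := by
  have hΛfin := hF.finite_netAlgebra (K := K) (L := L) hab hb
  have := hΛfin.1
  have hchar : CharZero K := charZero_of_injective_algebraMap (algebraMap ℂ K).injective
  have hΛ := hF.le_finrank_netAlgebra (K := K) (L := L) hab hb
  obtain ⟨hV, h1⟩ := hF.finrank_le_finrank_netSpan_prodXMul (K := K) (L := L) hab hb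
  have hY := hF.finrank_netSpan_prodXMul_two_le (K := K) (L := L) hab hb
  have hU := hF.finrank_le_finrank_netSpan (K := K) (L := L) hab hb (Or.inl rfl)
    (W := Sgr r (a, b)) (by simp)
  have hU' := hF.finrank_inf_span_pair_le
  have hq := two_mul_finrank_Sgr (r := r) (u := a) (v := b) hb.le (by linarith)
  have hg := two_mul_finrank_Sgr (r := r) (u := a - r - 2) (v := b - 2) (by linarith) (by linarith)
  have hm := two_mul_finrank_Sgr (r := r) (u := 2 * a - r - 2) (v := 2 * b - 2) (by linarith)
    (by linarith)
  set e := fun i => (Module.finBasis ℂ (Sgr r (a, b)) i : S)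
  have heq : netSpan K L (Sgr r (a, b)) =
      Submodule.span K (Set.range fun i => algebraMap S L (e i)) :=
    netSpan_eq_span_range _
  have hmem1 : ∀ i, algebraMap S L (e i) ∈ netAlgebra K L r a b := fun i =>
    netSpan_le_netAlgebra 1 (W := Sgr r (a, b)) (by simp) (mem_netSpan (Subtype.prop _))
  have hmul : ∀ p ∈ Sgr r (a, b), ∀ v ∈ netSpan K L (prodXMul r (a - r - 2, b - 2)),
      algebraMap S L p * v ∈ netSpan K L (prodXMul r (2 * a - r - 2, 2 * b - 2)) := by
    intro p hp v hv
    refine (Submodule.span_le (p := (netSpan K L (prodXMul r (2 * a - r - 2, 2 * b - 2))).comap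
      (LinearMap.mulLeft K (algebraMap S L p)))).mpr ?_ hv
    rintro _ ⟨_, ⟨α, hα, rfl⟩, rfl⟩
    rw [SetLike.mem_coe, Submodule.mem_comap, LinearMap.mulLeft_apply, LinearMap.mulLeft_apply,
      ← map_mul, mul_left_comm]
    exact mem_netSpan (mem_prodXMul (mul_mem_Sgr_two hp hα))
  obtain ⟨t, ht⟩ := Subalgebra.exists_combination_injective (F := ℂ) (netAlgebra K L r a b) hmem1
    (V := netSpan K L (prodXMul r (a - r - 2, b - 2)))
    (Y := netSpan K L (prodXMul r (2 * a - r - 2, 2 * b - 2)))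
    (netSpan_le_netAlgebra 1 (by simpa using prodXMul_le))
    (netSpan_le_netAlgebra 2 (by simpa using prodXMul_le))
    (fun i v hv => hmul _ (Subtype.prop _) v hv) (by zify at *; linarith)
    (by rw [← heq]; zify at *; linarith [hΛfin.2]) h1
  have hη : ∑ i, algebraMap ℂ K (t i) • algebraMap S L (e i) = algebraMap S L (∑ i, t i • e i) := by
    rw [map_sum]
    refine Finset.sum_congr rfl fun i _ => ?_
    rw [algebraMap_smul]
    exact (map_smul (IsScalarTower.toAlgHom ℂ S L) (t i) (e i)).symm
  rw [hη] at ht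
  set η := ∑ i, t i • e i
  have hηmem : η ∈ Sgr r (a, b) :=
    Submodule.sum_mem _ fun i _ => Submodule.smul_mem _ _ (Subtype.prop _)
  refine ⟨η, hηmem, fun α hα hJ => ?_⟩
  have hJ0 : X 0 * X 1 * X 2 * X 3 * (η * α) ∈ Ideal.span (Set.range ![F₀, F₁, F₂]) := by
    have h := Submodule.mem_colon.mp hJ _ (Ideal.mem_span_singleton_self _)
    rw [smul_eq_mul, mul_comm, hF.span_eq] at h
    rwa [Matrix.range_cons, Matrix.range_cons, Matrix.range_cons, Matrix.range_empty,
      Set.union_empty, Set.singleton_union, Set.singleton_union]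
  obtain ⟨c, hc, hcsum⟩ := exists_homogeneous_combination (r := r) (δ := (a, b))
    (γ := (2 * a, 2 * b)) (F := ![F₀, F₁, F₂])
    (by simp [Fin.forall_fin_succ, hF.mem₀, hF.mem₁, hF.mem₂])
    (prod_X_mul_mem_Sgr (mul_mem_Sgr_two hηmem hα)) hJ0
  have hc' : ∀ i, c i ∈ Sgr r (a, b) := fun i => by
    have h := hc i
    rwa [show ((2 * a, 2 * b) - (a, b) : ℤ × ℤ) = (a, b) by ext <;> simp <;> ring] at h
  have hzero := ht (algebraMap S L (X 0 * X 1 * X 2 * X 3 * α)) (mem_netSpan (mem_prodXMul hα))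
    fun v hv => by
      rw [← map_mul, mul_left_comm, hcsum, map_sum, Finset.sum_mul]
      refine Submodule.sum_mem _ fun i _ => ?_
      rw [mul_comm (c i), map_mul, mul_assoc]
      exact algebraMap_mul_mem F₀ F₁ F₂ (by fin_cases i <;> simp) (hmul _ (hc' i) v hv)
  rw [map_eq_zero_iff _ (FaithfulSMul.algebraMap_injective S L)] at hzero
  exact (mul_eq_zero.mp hzero).resolve_left prod_X_ne_zero

end FunctionField

theorem IsNet.exists_injective_of_isFractionRing {F₀ F₁ F₂ f : S} {r : ℕ} {a b : ℤ}
    (hF : IsNet r a b f F₀ F₁ F₂) (hab : (r : ℤ) * b < a)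
    (hb : 0 < b) (habK : (r : ℤ) * (b - 2) < a - r - 2) (hbK : 2 < b)
    (K L : Type*) [Field K] [Field L] [Algebra S L] [Algebra ℂ K] [Algebra ℂ L]
    [IsScalarTower ℂ S L] [Algebra (netRing F₀ F₁ F₂) K]
    [IsScalarTower ℂ (netRing F₀ F₁ F₂) K] [FaithfulSMul S L]
    [IsFractionRing (netRing F₀ F₁ F₂) K] :
    ∃ η ∈ Sgr r (a, b), ∀ α ∈ Sgr r (a - r - 2, b - 2), η * α ∈ J1 f → α = 0 := by
  have hinj : Function.Injective (algebraMap (netRing F₀ F₁ F₂) L) :=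
    (FaithfulSMul.algebraMap_injective S L).comp Subtype.val_injective
  let : Algebra K L := (IsFractionRing.lift hinj).toAlgebra
  have htower : IsScalarTower (netRing F₀ F₁ F₂) K L :=
    IsScalarTower.of_algebraMap_eq fun c => (IsFractionRing.lift_algebraMap hinj c).symm
  have : IsScalarTower ℂ K L := IsScalarTower.of_algebraMap_eq fun c => by
    rw [IsScalarTower.algebraMap_apply ℂ (netRing F₀ F₁ F₂) K,
      ← IsScalarTower.algebraMap_apply (netRing F₀ F₁ F₂) K L, IsScalarTower.algebraMap_apply ℂ S L]
    rfl
  exact hF.exists_injective hab hb habK hbK K L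

/-- Theorem for Hirzebruch surfaces: if `β = (a,b)`, `β + K`, and
`β + 2K` are all ample, `f ∈ S_β` is nondegenerate, and
`dim_ℂ (J₁(f) ∩ S_β) ≤ 9`, then there is `η ∈ S_β` such that multiplication by
`η` on `R₁(f)_{β+K} → R₁(f)_{2β+K}` is injective (stated elementwise), i.e. has
rank `g = dim_ℂ R₁(f)_{β+K}`. -/
theorem stmt_7 (r : ℕ) (a b : ℤ)
    (hβ : (r : ℤ) * b < a ∧ 0 < b)
    (hβK : (r : ℤ) * (b - 2) < a - r - 2 ∧ 2 < b)
    (hβ2K : (r : ℤ) * (b - 4) < a - 2 * r - 4 ∧ 4 < b)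
    (f : S) (hf : f ∈ Sgr r (a, b)) (hnd : Nondeg f)
    (hdim : Module.finrank ℂ
      ↥(Submodule.restrictScalars ℂ (J1 f) ⊓ Sgr r (a, b)) ≤ 9) :
    ∃ η ∈ Sgr r (a, b),
      ∀ α ∈ Sgr r (a - r - 2, b - 2), η * α ∈ J1 f → α ∈ J1 f := by
  obtain ⟨F₀, F₁, F₂, hF⟩ := exists_isNet hβ.1 hβ.2 hf hnd
  obtain ⟨η, hη, h⟩ := hF.exists_injective_of_isFractionRing hβ.1 hβ.2 hβK.1 hβK.2
    (FractionRing (netRing F₀ F₁ F₂)) (FractionRing S)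
  exact ⟨η, hη, fun α hα hJ => h α hα hJ ▸ zero_mem _⟩
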